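/- arXiv:2010.09282 — 11 statements merged into one kernel-verified Lean document; each statement's English description precedes it below -/
import Mathlib

section
/- Let d > 0, b = (−d/2, 0), m = (d/2, 0) in ℝ², and θ ∈ (0, π/2). Let k_I = (cos θ, sin θ). Then for every point r = (x, y) with x > 0 and y > 0, the specular-reflection condition (k_I · (b − r))/‖b − r‖ = (k_I · (m − r))/‖m − r‖ holds if and only if y² − x² + 2·cot(2θ)·x·y + d²/4 = 0. -/
open Real

/-- Euclidean norm on `ℝ × ℝ`. -/
noncomputable def norm2 (p : ℝ × ℝ) : ℝ := Real.sqrt (p.1 ^ 2 + p.2 ^ 2)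

/-- Dot product on `ℝ × ℝ`. -/
noncomputable def dotp (p q : ℝ × ℝ) : ℝ := p.1 * q.1 + p.2 * q.2

/-- With `P = c p + s y` and `Q = c q + s y` the components along `(c, s)` of `(p, y)` and `(q, y)`,
and `p > |q|`, the normalized components agree iff the line spanned by `(c, s)` is an axis of
symmetry of the lines spanned by `(p, y)` and `(q, y)`. -/
lemma component_div_norm_eq_iff {c s p q y A B : ℝ} (hc : 0 < c) (hs : 0 < s)
    (hcs : s ^ 2 + c ^ 2 = 1) (hy : 0 < y) (hpq : q < p) (hpq' : 0 < p + q)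
    (hA : 0 < A) (hB : 0 < B) (hA2 : A ^ 2 = p ^ 2 + y ^ 2) (hB2 : B ^ 2 = q ^ 2 + y ^ 2) :
    (c * p + s * y) / A = (c * q + s * y) / B ↔
      (c * p + s * y) * (s * q - c * y) + (c * q + s * y) * (s * p - c * y) = 0 := by
  have hp : 0 < p := by linarith
  have hP : 0 < c * p + s * y := by positivity
  have factor : ((c * p + s * y) * B) ^ 2 - ((c * q + s * y) * A) ^ 2 =
      -(y * (p - q)) *
        ((c * p + s * y) * (s * q - c * y) + (c * q + s * y) * (s * p - c * y)) := by
    rw [mul_pow, mul_pow, hA2, hB2]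
    linear_combination (-(y * (p - q)) *
      ((c * p + s * y) * (s * q - c * y) + (c * q + s * y) * (s * p - c * y)) -
      ((c * p + s * y) ^ 2 * (q ^ 2 + y ^ 2) - (c * q + s * y) ^ 2 * (p ^ 2 + y ^ 2))) * hcs
  have hne : -(y * (p - q)) ≠ 0 := (neg_neg_of_pos (mul_pos hy (sub_pos.2 hpq))).ne
  rw [div_eq_div_iff hA.ne' hB.ne']
  constructor
  · intro h
    rw [h, sub_self] at factor
    exact (mul_eq_zero.1 factor.symm).resolve_left hne
  · intro h
    have hQ : 0 < c * q + s * y := by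
      by_contra! hQ
      have hsy := mul_pos hs hy
      have hcy := mul_pos hc hy
      have hq : q < 0 := by
        by_contra! hq
        have := mul_nonneg hc.le hq
        linarith
      have hsq := mul_neg_of_pos_of_neg hs hq
      have hcpq := mul_pos hc hpq'
      have hsp := mul_pos hs hp
      nlinarith [mul_pos hP (show 0 < c * y - s * q by linarith),
        mul_nonneg (neg_nonneg.2 hQ) hsp.le,
        mul_pos (show 0 < (c * p + s * y) + (c * q + s * y) by linarith)
          (show 0 < c * y - s * q by linarith),
        mul_nonneg (neg_nonneg.2 hQ) (show 0 ≤ s * p - s * q by linarith)]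
    rw [h, mul_zero, sub_eq_zero] at factor
    exact (pow_left_inj₀ (by positivity) (by positivity) two_ne_zero).1 factor

/-- Lemma 1 (Reflection Hyperbola), first-quadrant case: for `r = (x, y)` with `x > 0`,
`y > 0`, the specular-reflection condition with respect to the internal normal
`k_I = (cos θ, sin θ)` holds iff `r` lies on the reflection hyperbola. -/
theorem stmt0 (d θ x y : ℝ) (hd : 0 < d) (hθ1 : 0 < θ) (hθ2 : θ < π / 2)
    (hx : 0 < x) (hy : 0 < y)
    (b m r k : ℝ × ℝ)
    (hb : b = (-(d / 2), 0)) (hm : m = (d / 2, 0)) (hr : r = (x, y))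
    (hk : k = (Real.cos θ, Real.sin θ)) :
    dotp k (b - r) / norm2 (b - r) = dotp k (m - r) / norm2 (m - r) ↔
      y ^ 2 - x ^ 2 + 2 * Real.cot (2 * θ) * x * y + d ^ 2 / 4 = 0 := by
  subst hb hm hr hk
  have hc : 0 < Real.cos θ := Real.cos_pos_of_mem_Ioo ⟨by linarith, hθ2⟩
  have hs : 0 < Real.sin θ := Real.sin_pos_of_pos_of_lt_pi hθ1 (by linarith)
  have hcs := Real.sin_sq_add_cos_sq θ
  have key := component_div_norm_eq_iff (p := x + d / 2) (q := x - d / 2) hc hs hcs hy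
    (by linarith) (by linarith) (Real.sqrt_pos.2 (by positivity))
    (Real.sqrt_pos.2 (by positivity)) (Real.sq_sqrt (by positivity))
    (Real.sq_sqrt (by positivity))
  have hnb : norm2 ((-(d / 2), 0) - (x, y)) = √((x + d / 2) ^ 2 + y ^ 2) := by
    simp only [norm2, Prod.mk_sub_mk]
    congr 1
    ring
  have hnm : norm2 ((d / 2, 0) - (x, y)) = √((x - d / 2) ^ 2 + y ^ 2) := by
    simp only [norm2, Prod.mk_sub_mk]
    congr 1
    ring
  have hdb : dotp (Real.cos θ, Real.sin θ) ((-(d / 2), 0) - (x, y)) =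
      -(Real.cos θ * (x + d / 2) + Real.sin θ * y) := by
    simp only [dotp, Prod.mk_sub_mk]
    ring
  have hdm : dotp (Real.cos θ, Real.sin θ) ((d / 2, 0) - (x, y)) =
      -(Real.cos θ * (x - d / 2) + Real.sin θ * y) := by
    simp only [dotp, Prod.mk_sub_mk]
    ring
  rw [hnb, hnm, hdb, hdm, neg_div, neg_div, neg_inj, key]
  have hyperbola : (Real.cos θ * (x + d / 2) + Real.sin θ * y) *
        (Real.sin θ * (x - d / 2) - Real.cos θ * y) +
      (Real.cos θ * (x - d / 2) + Real.sin θ * y) *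
        (Real.sin θ * (x + d / 2) - Real.cos θ * y) =
      -(2 * Real.sin θ * Real.cos θ) *
        (y ^ 2 - x ^ 2 + 2 * Real.cot (2 * θ) * x * y + d ^ 2 / 4) := by
    rw [Real.cot_eq_cos_div_sin, Real.sin_two_mul, Real.cos_two_mul']
    field_simp
    ring
  rw [hyperbola, mul_eq_zero, or_iff_right (neg_ne_zero.2 (by positivity))]
end

section
/- Let d > 0, b = (−d/2, 0), m = (d/2, 0) in ℝ², and θ ∈ (0, π/2). Let k_II = (−sin θ, cos θ). Then for every point r = (x, y) with x < 0 and y > 0, the specular-reflection condition (k_II · (b − r))/‖b − r‖ = (k_II · (m − r))/‖m − r‖ holds if and only if y² − x² + 2·cot(2θ)·x·y + d²/4 = 0. -/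
open Real

/-- If `(a, a')` and `(e, e')` are linearly independent with `e < 0`, then they make equal angles
with the first axis iff `a < 0` and their slopes are opposite. -/
theorem div_sqrt_eq_div_sqrt_iff_of_neg {a a' e e' : ℝ} (he : e < 0)
    (hdet : a * e' - e * a' ≠ 0) :
    a / √(a ^ 2 + a' ^ 2) = e / √(e ^ 2 + e' ^ 2) ↔ a < 0 ∧ a * e' + e * a' = 0 := by
  have hP0 : 0 < a ^ 2 + a' ^ 2 := by
    by_contra! h
    have ha : a = 0 := by nlinarith [sq_nonneg a, sq_nonneg a']
    have ha' : a' = 0 := by nlinarith [sq_nonneg a, sq_nonneg a']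
    simp [ha, ha'] at hdet
  have hQ0 : 0 < e ^ 2 + e' ^ 2 := by nlinarith [sq_nonneg e']
  have hP := Real.sqrt_pos.2 hP0
  have hQ := Real.sqrt_pos.2 hQ0
  have hP2 := Real.sq_sqrt hP0.le
  have hQ2 := Real.sq_sqrt hQ0.le
  set P := √(a ^ 2 + a' ^ 2)
  set Q := √(e ^ 2 + e' ^ 2)
  rw [div_eq_div_iff hP.ne' hQ.ne']
  constructor
  · intro h
    refine ⟨?_, ?_⟩
    · by_contra! ha
      nlinarith [mul_nonneg ha hQ.le, mul_neg_of_neg_of_pos he hP]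
    · have hsq : a ^ 2 * Q ^ 2 = e ^ 2 * P ^ 2 := by rw [← mul_pow, ← mul_pow, h]
      rw [hP2, hQ2] at hsq
      exact (mul_eq_zero.1 (show (a * e' - e * a') * (a * e' + e * a') = 0 by
        linear_combination hsq)).resolve_left hdet
  · rintro ⟨ha, h⟩
    have hsq : (a * Q) ^ 2 = (e * P) ^ 2 := by
      rw [mul_pow, mul_pow, hP2, hQ2]
      linear_combination (a * e' - e * a') * h
    rcases sq_eq_sq_iff_eq_or_eq_neg.1 hsq with h' | h'
    · exact h'
    · linarith [mul_neg_of_neg_of_pos ha hQ, mul_neg_of_neg_of_pos he hP]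

/-- On the second-quadrant part of the reflection hyperbola through `(±h, 0)`, the
point `(-h, 0)` lies strictly on the negative side of the reflector with normal `(-s, c)`. -/
theorem reflection_hyperbola_neg_side {h s c x y : ℝ} (hh : 0 < h) (hs : 0 < s) (hc : 0 < c)
    (hx : x < 0) (hy : 0 < y)
    (H : s * c * (y ^ 2 - x ^ 2 + h ^ 2) + (c ^ 2 - s ^ 2) * (x * y) = 0) :
    s * (h + x) - c * y < 0 := by
  by_contra! hA
  have hxy : x * y < 0 := mul_neg_of_neg_of_pos hx hy
  have hhx : 0 < h + x := by
    by_contra! hneg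
    nlinarith [mul_pos hc hy, mul_nonneg hs.le (neg_nonneg.2 hneg)]
  have hpos : 0 < y ^ 2 - x ^ 2 + h ^ 2 := by nlinarith [mul_pos hhx (show 0 < h - x by linarith)]
  have hcs : s < c := by
    by_contra! hle
    nlinarith [mul_pos (mul_pos hs hc) hpos,
      mul_nonneg (show 0 ≤ s ^ 2 - c ^ 2 by nlinarith) (neg_nonneg.2 hxy.le)]
  have hy' : y < h + x := by
    by_contra! hle
    nlinarith [mul_le_mul_of_nonneg_left hle hs.le, mul_lt_mul_of_pos_right hcs hy]
  have hperp : 0 < c * (h - x) - s * y := by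
    nlinarith [mul_lt_mul_of_pos_right hcs hy, mul_pos hc (show 0 < h - x - y by linarith)]
  have hdet : (s * (h + x) - c * y) * (c * (h - x) - s * y) = -(h * y * (s ^ 2 + c ^ 2)) := by
    linear_combination H
  have : 0 < h * y * (s ^ 2 + c ^ 2) := by positivity
  nlinarith [mul_nonneg hA hperp.le]

/-- Lemma 1 (Reflection Hyperbola), second-quadrant case: for `r = (x, y)` with `x < 0`,
`y > 0`, the specular-reflection condition with respect to the internal normal
`k_II = (-sin θ, cos θ)` holds iff `r` lies on the reflection hyperbola. -/
theorem stmt1 (d θ x y : ℝ) (hd : 0 < d) (hθ1 : 0 < θ) (hθ2 : θ < π / 2)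
    (hx : x < 0) (hy : 0 < y)
    (b m r k : ℝ × ℝ)
    (hb : b = (-(d / 2), 0)) (hm : m = (d / 2, 0)) (hr : r = (x, y))
    (hk : k = (-Real.sin θ, Real.cos θ)) :
    dotp k (b - r) / norm2 (b - r) = dotp k (m - r) / norm2 (m - r) ↔
      y ^ 2 - x ^ 2 + 2 * Real.cot (2 * θ) * x * y + d ^ 2 / 4 = 0 := by
  subst hb hm hr hk
  have hs : 0 < sin θ := sin_pos_of_pos_of_lt_pi hθ1 (by linarith [pi_pos])
  have hc : 0 < cos θ := cos_pos_of_mem_Ioo ⟨by linarith, hθ2⟩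
  have hsc : sin θ ^ 2 + cos θ ^ 2 = 1 := sin_sq_add_cos_sq θ
  rw [Real.cot_eq_cos_div_sin, sin_two_mul, cos_two_mul']
  simp only [dotp, norm2, Prod.mk_sub_mk]
  set s := sin θ
  set c := cos θ
  have hhyp : y ^ 2 - x ^ 2 + 2 * ((c ^ 2 - s ^ 2) / (2 * s * c)) * x * y + d ^ 2 / 4 = 0 ↔
      s * c * (y ^ 2 - x ^ 2 + (d / 2) ^ 2) + (c ^ 2 - s ^ 2) * (x * y) = 0 := by
    rw [← mul_eq_zero_iff_left (mul_pos hs hc).ne']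
    field_simp
    ring_nf
  have hN : (-(d / 2) - x) ^ 2 + (0 - y) ^ 2 =
      (s * (d / 2 + x) - c * y) ^ 2 + (-c * (d / 2 + x) - s * y) ^ 2 := by
    linear_combination (-((d / 2 + x) ^ 2 + y ^ 2)) * hsc
  have hM : (d / 2 - x) ^ 2 + (0 - y) ^ 2 =
      (s * (x - d / 2) - c * y) ^ 2 + (c * (d / 2 - x) - s * y) ^ 2 := by
    linear_combination (-((d / 2 - x) ^ 2 + y ^ 2)) * hsc
  have hA : -s * (-(d / 2) - x) + c * (0 - y) = s * (d / 2 + x) - c * y := by ring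
  have hB : -s * (d / 2 - x) + c * (0 - y) = s * (x - d / 2) - c * y := by ring
  have hBneg : s * (x - d / 2) - c * y < 0 := by
    nlinarith [mul_pos hc hy, mul_pos hs (show 0 < d / 2 - x by linarith)]
  have hdet : (s * (d / 2 + x) - c * y) * (c * (d / 2 - x) - s * y) -
      (s * (x - d / 2) - c * y) * (-c * (d / 2 + x) - s * y) ≠ 0 := by
    have : 0 < d * y := mul_pos hd hy
    refine ne_of_lt ?_
    linear_combination this - d * y * hsc
  rw [hhyp, hA, hB, hN, hM, div_sqrt_eq_div_sqrt_iff_of_neg hBneg hdet]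
  constructor
  · rintro ⟨-, H⟩
    linear_combination H / 2
  · intro H
    exact ⟨reflection_hyperbola_neg_side (half_pos hd) hs hc hx hy H, by linear_combination 2 * H⟩
end

section
/- Let d > 0, θ ∈ (0, π/2), and d < s < ∞. Set u = s/2, v = √(s² − d²)/2, z₁ = s⁴ cot²θ / (4(s² csc²θ − d²)), and z₂ = s⁴ tan²θ / (4(s² sec²θ − d²)). Then the set of points (x, y) ∈ ℝ² satisfying both y² − x² + 2·cot(2θ)·x·y + d²/4 = 0 and x²/u² + y²/v² = 1 is exactly the four-point set { h_I(s), h_II(s), −h_I(s), −h_II(s) }, where h_I(s) = (√z₁, (v/u)√(u² − z₁)) and h_II(s) = (−√z₂, (v/u)√(u² − z₂)). -/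
open Real

/-- With both equations cleared of denominators, the hyperbola of asymptotic slopes `t` and `-1 / t`
meets the ellipse with squared semi-axes `s ^ 2 / 4` and `w ^ 2 / 4` in four explicit points. -/
theorem hyperbola_inter_ellipse_iff {s w t A B x y : ℝ} (hs : 0 < s) (hw : 0 < w) (ht : 0 < t)
    (hA : 0 < A) (hB : 0 < B) (hA2 : A ^ 2 = s ^ 2 + t ^ 2 * w ^ 2)
    (hB2 : B ^ 2 = s ^ 2 * t ^ 2 + w ^ 2) :
    (t * (y ^ 2 - x ^ 2) + (1 - t ^ 2) * x * y + t * (s ^ 2 - w ^ 2) / 4 = 0 ∧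
        4 * x ^ 2 * w ^ 2 + 4 * y ^ 2 * s ^ 2 = s ^ 2 * w ^ 2) ↔
      ((x = s ^ 2 / (2 * A) ∧ y = t * w ^ 2 / (2 * A)) ∨
        (x = -(s ^ 2 * t / (2 * B)) ∧ y = w ^ 2 / (2 * B)) ∨
        (x = -(s ^ 2 / (2 * A)) ∧ y = -(t * w ^ 2 / (2 * A))) ∨
        (x = s ^ 2 * t / (2 * B) ∧ y = -(w ^ 2 / (2 * B)))) := by
  have hs2 : s ^ 2 ≠ 0 := by positivity
  constructor
  · rintro ⟨h1, h2⟩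
    have h3 : (s ^ 2 * y - t * w ^ 2 * x) * (t * s ^ 2 * y + w ^ 2 * x) = 0 := by
      linear_combination s ^ 2 * w ^ 2 * h1 + t * (s ^ 2 - w ^ 2) / 4 * h2
    rcases mul_eq_zero.1 h3 with h | h
    · have hy : y = t * w ^ 2 * x / s ^ 2 := by
        rw [eq_div_iff hs2]; linear_combination h
      have h4 : (2 * A * x) ^ 2 = (s ^ 2) ^ 2 := by
        rw [hy] at h2
        field_simp at h2
        linear_combination 4 * x ^ 2 * hA2 + h2
      rcases sq_eq_sq_iff_eq_or_eq_neg.1 h4 with h5 | h5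
      · left
        have hx : x = s ^ 2 / (2 * A) := by
          field_simp; linear_combination h5
        exact ⟨hx, by rw [hy, hx]; field_simp⟩
      · right; right; left
        have hx : x = -(s ^ 2 / (2 * A)) := by
          field_simp; linear_combination h5
        exact ⟨hx, by rw [hy, hx]; field_simp⟩
    · have hx : x = -(t * s ^ 2 * y / w ^ 2) := by
        field_simp; linear_combination h
      have h4 : (2 * B * y) ^ 2 = (w ^ 2) ^ 2 := by
        rw [hx] at h2
        field_simp at h2
        linear_combination 4 * y ^ 2 * hB2 + h2
      rcases sq_eq_sq_iff_eq_or_eq_neg.1 h4 with h5 | h5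
      · right; left
        have hy : y = w ^ 2 / (2 * B) := by
          field_simp; linear_combination h5
        exact ⟨by rw [hx, hy]; field_simp, hy⟩
      · right; right; right
        have hy : y = -(w ^ 2 / (2 * B)) := by
          field_simp; linear_combination h5
        exact ⟨by rw [hx, hy]; field_simp, hy⟩
  · rintro (⟨rfl, rfl⟩ | ⟨rfl, rfl⟩ | ⟨rfl, rfl⟩ | ⟨rfl, rfl⟩) <;> constructor <;> field_simp <;>
      simp only [hA2, hB2] <;> ring



/-- Lemma 2 (Boundary PRPs): for `d < s < ∞`, the reflection hyperbola `H_θ`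
intersects the boundary of the `s`-ellipse in exactly the four points
`h_I(s), h_II(s), -h_I(s), -h_II(s)`. -/
theorem stmt4 (d θ s : ℝ) (hd : 0 < d) (hθ1 : 0 < θ) (hθ2 : θ < π / 2) (hs : d < s)
    (u v z1 z2 : ℝ) (hu : u = s / 2) (hv : v = Real.sqrt (s ^ 2 - d ^ 2) / 2)
    (hz1 : z1 = s ^ 4 * Real.cot θ ^ 2 / (4 * (s ^ 2 * (1 / Real.sin θ) ^ 2 - d ^ 2)))
    (hz2 : z2 = s ^ 4 * Real.tan θ ^ 2 / (4 * (s ^ 2 * (1 / Real.cos θ) ^ 2 - d ^ 2)))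
    (hI hII : ℝ × ℝ)
    (hhI : hI = (Real.sqrt z1, v / u * Real.sqrt (u ^ 2 - z1)))
    (hhII : hII = (-Real.sqrt z2, v / u * Real.sqrt (u ^ 2 - z2))) :
    {p : ℝ × ℝ | p.2 ^ 2 - p.1 ^ 2 + 2 * Real.cot (2 * θ) * p.1 * p.2 + d ^ 2 / 4 = 0 ∧
        p.1 ^ 2 / u ^ 2 + p.2 ^ 2 / v ^ 2 = 1} =
      {hI, hII, -hI, -hII} := by
  have hs0 : 0 < s := hd.trans hs
  have hsd : 0 < s ^ 2 - d ^ 2 := by nlinarith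
  have hsin : 0 < Real.sin θ := Real.sin_pos_of_pos_of_lt_pi hθ1 (by linarith [Real.pi_pos])
  have hcos : 0 < Real.cos θ := Real.cos_pos_of_mem_Ioo ⟨by linarith, hθ2⟩
  have hsc := Real.sin_sq_add_cos_sq θ
  obtain ⟨w, hw⟩ : ∃ w, w = Real.sqrt (s ^ 2 - d ^ 2) := ⟨_, rfl⟩
  have hw0 : 0 < w := hw ▸ Real.sqrt_pos.2 hsd
  have hw2 : w ^ 2 = s ^ 2 - d ^ 2 := hw ▸ Real.sq_sqrt hsd.le
  have hd2 : d ^ 2 = s ^ 2 - w ^ 2 := by linarith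
  obtain ⟨t, htdef⟩ : ∃ t, t = Real.tan θ := ⟨_, rfl⟩
  have htsc : t = Real.sin θ / Real.cos θ := htdef.trans (Real.tan_eq_sin_div_cos θ)
  have ht : 0 < t := htsc ▸ div_pos hsin hcos
  have hcot : Real.cot θ = 1 / t := by
    rw [Real.cot_eq_cos_div_sin, htsc, one_div_div]
  have hcsc : (1 / Real.sin θ) ^ 2 = 1 + 1 / t ^ 2 := by
    rw [htsc]; field_simp; linarith
  have hsec : (1 / Real.cos θ) ^ 2 = 1 + t ^ 2 := by
    rw [htsc]; field_simp; linarith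
  have hcot2 : 2 * Real.cot (2 * θ) = (1 - t ^ 2) / t := by
    rw [Real.cot_eq_cos_div_sin, Real.cos_two_mul', Real.sin_two_mul, htsc]
    field_simp
  obtain ⟨A, hA, hA2⟩ : ∃ A, 0 < A ∧ A ^ 2 = s ^ 2 + t ^ 2 * w ^ 2 :=
    ⟨√(s ^ 2 + t ^ 2 * w ^ 2), by positivity, Real.sq_sqrt (by positivity)⟩
  obtain ⟨B, hB, hB2⟩ : ∃ B, 0 < B ∧ B ^ 2 = s ^ 2 * t ^ 2 + w ^ 2 :=
    ⟨√(s ^ 2 * t ^ 2 + w ^ 2), by positivity, Real.sq_sqrt (by positivity)⟩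
  have hz1' : z1 = (s ^ 2 / (2 * A)) ^ 2 := by
    have h : s ^ 2 * (1 + 1 / t ^ 2) - d ^ 2 = A ^ 2 / t ^ 2 := by
      rw [hA2, hd2]; field_simp; ring
    rw [hz1, hcsc, hcot, h]; field_simp; ring
  have hz2' : z2 = (s ^ 2 * t / (2 * B)) ^ 2 := by
    have h : s ^ 2 * (1 + t ^ 2) - d ^ 2 = B ^ 2 := by rw [hB2, hd2]; ring
    rw [hz2, hsec, ← htdef, h]; field_simp; ring
  have huz1 : u ^ 2 - z1 = (s * t * w / (2 * A)) ^ 2 := by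
    rw [hu, hz1']; field_simp; rw [hA2]; ring
  have huz2 : u ^ 2 - z2 = (s * w / (2 * B)) ^ 2 := by
    rw [hu, hz2']; field_simp; rw [hB2]; ring
  have hI' : hI = (s ^ 2 / (2 * A), t * w ^ 2 / (2 * A)) := by
    rw [hhI, huz1, hz1', Real.sqrt_sq (by positivity), Real.sqrt_sq (by positivity), hv, hu, ← hw]
    congr 1; field_simp
  have hII' : hII = (-(s ^ 2 * t / (2 * B)), w ^ 2 / (2 * B)) := by
    rw [hhII, huz2, hz2', Real.sqrt_sq (by positivity), Real.sqrt_sq (by positivity), hv, hu, ← hw]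
    congr 1; field_simp
  ext ⟨x, y⟩
  simp only [Set.mem_ofPred_eq, Set.mem_insert_iff, Set.mem_singleton_iff, hI', hII', Prod.neg_mk,
    Prod.mk.injEq, neg_neg]
  rw [← hyperbola_inter_ellipse_iff hs0 hw0 ht hA hB hA2 hB2, hcot2, hv, hu, ← hw, hd2]
  refine and_congr ?_ ?_
  · have h : t * (y ^ 2 - x ^ 2 + (1 - t ^ 2) / t * x * y + (s ^ 2 - w ^ 2) / 4) =
        t * (y ^ 2 - x ^ 2) + (1 - t ^ 2) * x * y + t * (s ^ 2 - w ^ 2) / 4 := by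
      field_simp
    rw [← h, mul_eq_zero, or_iff_right ht.ne']
  · have h : x ^ 2 / (s / 2) ^ 2 + y ^ 2 / (w / 2) ^ 2 =
        (4 * x ^ 2 * w ^ 2 + 4 * y ^ 2 * s ^ 2) / (s ^ 2 * w ^ 2) := by
      field_simp; ring
    rw [h, div_eq_one_iff_eq (by positivity)]
end

section
/- Let w > 0, θ ∈ (0, π/2), and p, q ∈ ℝ² with p ≠ q. Let η ∈ (−π/2, π/2] be the inclination angle of the segment from p to q (η = arctan((q₂ − p₂)/(q₁ − p₁)) if q₁ ≠ p₁, and η = π/2 if q₁ = p₁). Then the 2-dimensional Lebesgue measure of the Minkowski sum L_{[p,q]} ⊕ R_{w,θ,0} equals √2 · w · ‖p − q‖ · sin(π/4 + θ − η) + w² if 0 ≤ θ − η ≤ π/2, and equals √2 · w · ‖p − q‖ · |sin(−π/4 + θ − η)| + w² otherwise. Moreover, if p = q the measure equals w². -/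
open Real MeasureTheory Pointwise

/-- Counterclockwise rotation by `θ` on `ℝ × ℝ`. -/
noncomputable def rotCCW (θ : ℝ) (p : ℝ × ℝ) : ℝ × ℝ :=
  (p.1 * Real.cos θ - p.2 * Real.sin θ, p.1 * Real.sin θ + p.2 * Real.cos θ)

/-- The closed square `R_{w,θ,0}` of side length `w` centered at the origin with edges
rotated counterclockwise by `θ`. -/
noncomputable def reflSquare (w θ : ℝ) : Set (ℝ × ℝ) :=
  rotCCW θ '' (Set.Icc (-(w / 2)) (w / 2) ×ˢ Set.Icc (-(w / 2)) (w / 2))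

theorem volume_add_Icc {s : Set ℝ} (hs : IsCompact s) (hc : IsConnected s) {h : ℝ} (hh : 0 ≤ h) :
    volume (s + Set.Icc (-h) h) = volume s + ENNReal.ofReal (2 * h) := by
  obtain ⟨l, u, rfl⟩ : ∃ l u, s = Set.Icc l u := ⟨_, _, eq_Icc_of_connected_compact hc hs⟩
  have hlu : l ≤ u := Set.nonempty_Icc.1 hc.nonempty
  rw [Set.Icc_add_Icc hlu (by linarith), Real.volume_Icc, Real.volume_Icc,
    ← ENNReal.ofReal_add (by linarith) (by linarith)]
  congr 1
  ring

theorem volume_image_affine (p q : ℝ) (s : Set ℝ) :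
    volume ((fun t => (1 - t) * p + t * q) '' s) = ENNReal.ofReal |q - p| * volume s := by
  have : (fun t => (1 - t) * p + t * q) '' s = (fun x => p + x) '' ((q - p) • s) := by
    rw [← Set.image_smul, Set.image_image]
    refine Set.image_congr fun t _ => ?_
    simp only [smul_eq_mul]
    ring
  rw [this, Set.image_add_left, measure_preimage_add, Measure.addHaar_smul]
  simp

theorem volume_segment_add_Icc_prod_Icc (p q : ℝ × ℝ) {h : ℝ} (hh : 0 ≤ h) :
    volume (segment ℝ p q + Set.Icc (-h) h ×ˢ Set.Icc (-h) h) =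
      ENNReal.ofReal (2 * h * (|q.1 - p.1| + |q.2 - p.2|) + (2 * h) ^ 2) := by
  set I : Set ℝ := Set.Icc (-h) h with hI
  set f : ℝ → ℝ := fun t => (1 - t) * p.1 + t * q.1 with hf
  set g : ℝ → ℝ := fun t => (1 - t) * p.2 + t * q.2 with hg
  have hfc : Continuous f := by fun_prop
  have hgc : Continuous g := by fun_prop
  let U : Set (ℝ × ℝ) := {z | z.2 ∈ Set.Icc (0 : ℝ) 1 ∧ z.1 - f z.2 ∈ I}
  have hU : IsClosed U :=
    (isClosed_Icc.preimage continuous_snd).inter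
      (isClosed_Icc.preimage (continuous_fst.sub (hfc.comp continuous_snd)))
  let T : ℝ → Set ℝ := fun x => Prod.mk x ⁻¹' U
  have hTcpt : ∀ x, IsCompact (T x) := fun x =>
    isCompact_Icc.of_isClosed_subset (hU.preimage (by fun_prop)) fun t ht => ht.1
  have hTconv : ∀ x, Convex ℝ (T x) := by
    rintro x s ⟨hs, hs1, hs2⟩ t ⟨ht, ht1, ht2⟩ a b ha hb hab
    refine ⟨convex_Icc (0 : ℝ) 1 hs ht ha hb hab, ?_⟩
    have key : x - f (a • s + b • t) = a • (x - f s) + b • (x - f t) := by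
      simp only [hf, smul_eq_mul]
      obtain rfl : b = 1 - a := by linarith
      ring
    change x - f (a • s + b • t) ∈ I
    rw [key]
    exact convex_Icc (-h) h ⟨hs1, hs2⟩ ⟨ht1, ht2⟩ ha hb hab
  have hN : {x | (T x).Nonempty} = f '' Set.Icc 0 1 + I := by
    ext x
    simp only [Set.mem_ofPred_eq, Set.mem_add, Set.Nonempty]
    constructor
    · rintro ⟨t, ht, htI⟩
      exact ⟨f t, ⟨t, ht, rfl⟩, x - f t, htI, by ring⟩
    · rintro ⟨_, ⟨t, ht, rfl⟩, y, hy, rfl⟩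
      exact ⟨t, ht, by simpa using hy⟩
  have hslice : ∀ x, Prod.mk x ⁻¹' (segment ℝ p q + I ×ˢ I) = g '' T x + I := by
    intro x
    ext y
    simp only [Set.mem_preimage, Set.mem_add, segment_eq_image]
    constructor
    · rintro ⟨_, ⟨t, ht, rfl⟩, ⟨u, v⟩, ⟨hu, hv⟩, he⟩
      simp only [Prod.ext_iff, Prod.fst_add, Prod.snd_add, Prod.smul_fst, Prod.smul_snd,
        smul_eq_mul] at he
      refine ⟨g t, ⟨t, ⟨ht, ?_⟩, rfl⟩, v, hv, he.2⟩
      have : x - f t = u := by rw [← he.1]; simp [hf]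
      simpa [this] using hu
    · rintro ⟨_, ⟨t, ⟨ht, htI⟩, rfl⟩, v, hv, rfl⟩
      refine ⟨_, ⟨t, ht, rfl⟩, (x - f t, v), ⟨htI, hv⟩, ?_⟩
      ext <;> simp [hf, hg]
  have hNm : MeasurableSet {x | (T x).Nonempty} := by
    rw [hN]
    exact ((isCompact_Icc.image hfc).add isCompact_Icc).measurableSet
  have hvol : ∀ x, volume (Prod.mk x ⁻¹' (segment ℝ p q + I ×ˢ I)) =
      ENNReal.ofReal |q.2 - p.2| * volume (T x) +
        {x | (T x).Nonempty}.indicator (fun _ => ENNReal.ofReal (2 * h)) x := by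
    intro x
    rw [hslice]
    by_cases hx : (T x).Nonempty
    · rw [volume_add_Icc ((hTcpt x).image hgc)
        (((hTconv x).isConnected hx).image g hgc.continuousOn) hh, volume_image_affine,
        Set.indicator_of_mem (show x ∈ {x | (T x).Nonempty} from hx)]
    · rw [Set.indicator_of_notMem (show x ∉ {x | (T x).Nonempty} from hx),
        Set.not_nonempty_iff_eq_empty.1 hx]
      simp
  have hseg : IsCompact (segment ℝ p q) := by
    rw [segment_eq_image]
    exact isCompact_Icc.image (by fun_prop)
  have hUvol : ∫⁻ x, volume (T x) = ENNReal.ofReal (2 * h) := by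
    rw [← Measure.prod_apply hU.measurableSet, Measure.prod_apply_symm hU.measurableSet]
    have : ∀ t, volume ((fun x => (x, t)) ⁻¹' U) =
        (Set.Icc (0 : ℝ) 1).indicator (fun _ => ENNReal.ofReal (2 * h)) t := by
      intro t
      by_cases ht : t ∈ Set.Icc (0 : ℝ) 1
      · have : (fun x => (x, t)) ⁻¹' U = Set.Icc (f t - h) (f t + h) := by
          ext x
          constructor
          · rintro ⟨-, h1, h2⟩
            constructor <;> linarith
          · rintro ⟨h1, h2⟩
            refine ⟨ht, ?_, ?_⟩ <;> linarith
        rw [this, Real.volume_Icc, Set.indicator_of_mem ht]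
        congr 1
        ring
      · have : (fun x => (x, t)) ⁻¹' U = ∅ :=
          Set.eq_empty_of_forall_notMem fun x hx => ht hx.1
        rw [this, Set.indicator_of_notMem ht, measure_empty]
    rw [lintegral_congr this]
    rw [lintegral_indicator_const measurableSet_Icc]
    simp
  have hTm : Measurable fun x => volume (T x) := measurable_measure_prodMk_left hU.measurableSet
  rw [Measure.volume_eq_prod, Measure.prod_apply
    (hseg.add (isCompact_Icc.prod isCompact_Icc)).measurableSet]
  rw [lintegral_congr hvol]
  rw [lintegral_add_left (hTm.const_mul _), lintegral_const_mul _ hTm, hUvol,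
    lintegral_indicator_const hNm, hN, volume_add_Icc (isCompact_Icc.image hfc)
      ((isConnected_Icc zero_le_one).image f hfc.continuousOn) hh, volume_image_affine]
  rw [Real.volume_Icc, ← ENNReal.ofReal_mul (by positivity), ← ENNReal.ofReal_mul (by positivity),
    ← ENNReal.ofReal_add (by positivity) (by positivity), ← ENNReal.ofReal_mul (by positivity),
    ← ENNReal.ofReal_add (by positivity) (by positivity)]
  congr 1
  ring

/-- `rotCCW` as a linear map. -/
noncomputable def rotCCWLinear (θ : ℝ) : ℝ × ℝ →ₗ[ℝ] ℝ × ℝ :=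
  Matrix.toLin (Module.Basis.finTwoProd ℝ) (Module.Basis.finTwoProd ℝ)
    !![cos θ, -sin θ; sin θ, cos θ]

theorem rotCCWLinear_apply (θ : ℝ) (p : ℝ × ℝ) : rotCCWLinear θ p = rotCCW θ p := by
  rw [rotCCWLinear, Matrix.toLin_finTwoProd_apply, rotCCW]
  ext <;> simp only <;> ring

theorem det_rotCCWLinear (θ : ℝ) : LinearMap.det (rotCCWLinear θ) = 1 := by
  rw [rotCCWLinear, LinearMap.det_toLin, Matrix.det_fin_two_of]
  linear_combination sin_sq_add_cos_sq θ

theorem rotCCW_rotCCW_neg (θ : ℝ) (p : ℝ × ℝ) : rotCCW θ (rotCCW (-θ) p) = p := by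
  ext
  · simp only [rotCCW, cos_neg, sin_neg]
    linear_combination p.1 * sin_sq_add_cos_sq θ
  · simp only [rotCCW, cos_neg, sin_neg]
    linear_combination p.2 * sin_sq_add_cos_sq θ

theorem volume_segment_add_reflSquare {w : ℝ} (hw : 0 ≤ w) (θ : ℝ) (p q : ℝ × ℝ) :
    volume (segment ℝ p q + reflSquare w θ) = ENNReal.ofReal
      (w * (|(q.1 - p.1) * cos θ + (q.2 - p.2) * sin θ| +
        |(q.2 - p.2) * cos θ - (q.1 - p.1) * sin θ|) + w ^ 2) := by
  have hset : segment ℝ p q + reflSquare w θ = rotCCWLinear θ ''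
      (segment ℝ (rotCCW (-θ) p) (rotCCW (-θ) q) +
        Set.Icc (-(w / 2)) (w / 2) ×ˢ Set.Icc (-(w / 2)) (w / 2)) := by
    have hcoe : ⇑(rotCCWLinear θ) = rotCCW θ := funext (rotCCWLinear_apply θ)
    rw [Set.image_add, reflSquare, ← hcoe]
    congr 1
    have h := image_segment ℝ (rotCCWLinear θ).toAffineMap (rotCCW (-θ) p) (rotCCW (-θ) q)
    simp only [LinearMap.coe_toAffineMap] at h
    rw [h, rotCCWLinear_apply, rotCCWLinear_apply, rotCCW_rotCCW_neg, rotCCW_rotCCW_neg]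
  rw [hset, Measure.addHaar_image_linearMap, det_rotCCWLinear,
    volume_segment_add_Icc_prod_Icc _ _ (by positivity)]
  simp only [rotCCW, cos_neg, sin_neg, abs_one, ENNReal.ofReal_one, one_mul]
  congr 1
  have h1 : q.1 * cos θ - q.2 * -sin θ - (p.1 * cos θ - p.2 * -sin θ) =
    (q.1 - p.1) * cos θ + (q.2 - p.2) * sin θ := by ring
  have h2 : q.1 * -sin θ + q.2 * cos θ - (p.1 * -sin θ + p.2 * cos θ) =
    (q.2 - p.2) * cos θ - (q.1 - p.1) * sin θ := by ring
  rw [h1, h2]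
  ring

theorem exists_polar_of_inclination {p q : ℝ × ℝ} {η : ℝ}
    (hη : η = (if q.1 = p.1 then π / 2 else Real.arctan ((q.2 - p.2) / (q.1 - p.1)))) :
    ∃ c : ℝ, q.1 - p.1 = c * cos η ∧ q.2 - p.2 = c * sin η := by
  split_ifs at hη with h
  · exact ⟨q.2 - p.2, by simp [hη, h], by simp [hη]⟩
  · have hd : q.1 - p.1 ≠ 0 := sub_ne_zero.2 h
    have hc : cos η ≠ 0 := by rw [hη]; exact (cos_arctan_pos _).ne'
    have ht : sin η / cos η = (q.2 - p.2) / (q.1 - p.1) := by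
      rw [← tan_eq_sin_div_cos, hη, tan_arctan]
    refine ⟨(q.1 - p.1) / cos η, by field_simp, ?_⟩
    rw [div_mul_eq_mul_div, mul_div_assoc, ht]
    field_simp

theorem sqrt_two_mul_sin_pi_div_four_add (x : ℝ) : √2 * sin (π / 4 + x) = cos x + sin x := by
  rw [sin_add, sin_pi_div_four, cos_pi_div_four]
  linear_combination (cos x + sin x) / 2 * Real.sq_sqrt (zero_le_two : (0 : ℝ) ≤ 2)

theorem volume_segment_add_reflSquare_of_inclination {w : ℝ} (hw : 0 ≤ w) (θ : ℝ) {p q : ℝ × ℝ}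
    {η : ℝ}
    (hη : η = (if q.1 = p.1 then π / 2 else Real.arctan ((q.2 - p.2) / (q.1 - p.1)))) :
    volume (segment ℝ p q + reflSquare w θ) = ENNReal.ofReal
      (w * norm2 (p - q) * (|cos (θ - η)| + |sin (θ - η)|) + w ^ 2) := by
  obtain ⟨c, h1, h2⟩ := exists_polar_of_inclination hη
  have hn : norm2 (p - q) = |c| := by
    rw [norm2, ← Real.sqrt_sq_eq_abs]
    congr 1
    simp only [Prod.fst_sub, Prod.snd_sub]
    linear_combination (q.1 - p.1 + c * cos η) * h1 + (q.2 - p.2 + c * sin η) * h2 +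
      c ^ 2 * sin_sq_add_cos_sq η
  have e1 : c * cos η * cos θ + c * sin η * sin θ = c * cos (θ - η) := by
    rw [cos_sub]; ring
  have e2 : c * sin η * cos θ - c * cos η * sin θ = -(c * sin (θ - η)) := by
    rw [sin_sub]; ring
  rw [volume_segment_add_reflSquare hw, h1, h2, hn, e1, e2, abs_neg, abs_mul, abs_mul]
  congr 1
  ring

/-- Lemma 3 (measure of the Minkowski sum of a segment and a rotated square):
for `p ≠ q` with inclination angle `η`, `μ₂(L_{[p,q]} ⊕ R_{w,θ,0})` is given by the
stated piecewise formula, and for `p = q` it equals `w²`. -/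
theorem stmt7 (w θ : ℝ) (hw : 0 < w) (hθ1 : 0 < θ) (hθ2 : θ < π / 2) (p q : ℝ × ℝ) :
    (p ≠ q →
      ∀ η : ℝ,
        η = (if q.1 = p.1 then π / 2 else Real.arctan ((q.2 - p.2) / (q.1 - p.1))) →
        ((0 ≤ θ - η ∧ θ - η ≤ π / 2 →
          volume (segment ℝ p q + reflSquare w θ) =
            ENNReal.ofReal
              (Real.sqrt 2 * w * norm2 (p - q) * Real.sin (π / 4 + θ - η) + w ^ 2)) ∧
        (¬(0 ≤ θ - η ∧ θ - η ≤ π / 2) →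
          volume (segment ℝ p q + reflSquare w θ) =
            ENNReal.ofReal
              (Real.sqrt 2 * w * norm2 (p - q) * |Real.sin (-(π / 4) + θ - η)| + w ^ 2)))) ∧
    (p = q →
      volume (segment ℝ p q + reflSquare w θ) = ENNReal.ofReal (w ^ 2)) := by
  refine ⟨fun _ η hη => ⟨?_, ?_⟩, ?_⟩
  · rintro ⟨h0, h1⟩
    rw [volume_segment_add_reflSquare_of_inclination hw.le θ hη,
      abs_of_nonneg (cos_nonneg_of_neg_pi_div_two_le_of_le (by linarith) h1),
      abs_of_nonneg (sin_nonneg_of_nonneg_of_le_pi h0 (by linarith)),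
      ← sqrt_two_mul_sin_pi_div_four_add, ← add_sub_assoc]
    congr 1
    ring
  · intro hφ
    have hη1 : -(π / 2) < η ∧ η ≤ π / 2 := by
      rw [hη]
      split_ifs
      · constructor <;> linarith
      · exact ⟨neg_pi_div_two_lt_arctan _, (arctan_lt_pi_div_two _).le⟩
    have key : √2 * |sin (-(π / 4) + θ - η)| = |cos (θ - η)| + |sin (θ - η)| := by
      have h : √2 * |sin (-(π / 4) + θ - η)| = |cos (θ - η) - sin (θ - η)| := by
        have h' := sqrt_two_mul_sin_pi_div_four_add (-(θ - η))
        rw [cos_neg, sin_neg] at h'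
        rw [sub_eq_add_neg (cos _), ← h', abs_mul, abs_of_nonneg (sqrt_nonneg 2),
          ← abs_neg (sin (π / 4 + _)), ← sin_neg]
        ring_nf
      rw [h]
      rcases lt_or_ge (θ - η) 0 with hn | hn
      · have hc : 0 ≤ cos (θ - η) :=
          cos_nonneg_of_neg_pi_div_two_le_of_le (by linarith) (by linarith)
        have hs : sin (θ - η) ≤ 0 := sin_nonpos_of_nonpos_of_neg_pi_le hn.le (by linarith)
        rw [abs_of_nonneg hc, abs_of_nonpos hs, abs_of_nonneg (by linarith)]
        ring
      · have hp : π / 2 < θ - η := by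
          by_contra! hp
          exact hφ ⟨hn, hp⟩
        have hc : cos (θ - η) ≤ 0 :=
          cos_nonpos_of_pi_div_two_le_of_le hp.le (by linarith)
        have hs : 0 ≤ sin (θ - η) := sin_nonneg_of_nonneg_of_le_pi hn (by linarith)
        rw [abs_of_nonneg hs, abs_of_nonpos hc, abs_of_nonpos (by linarith)]
        ring
    rw [volume_segment_add_reflSquare_of_inclination hw.le θ hη, ← key]
    congr 1
    ring
  · rintro rfl
    rw [volume_segment_add_reflSquare hw.le]
    simp
end

section
/- Let w > 0, θ ∈ ℝ, and p, q ∈ ℝ². Then the 2-dimensional Lebesgue measure of the Minkowski sum L_{[p,q]} ⊕ R_{w,θ,0} satisfies μ₂(L_{[p,q]} ⊕ R_{w,θ,0}) ≥ w · ‖p − q‖ + w². -/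
open Real MeasureTheory Pointwise

/-- A linear map of the plane given by a matrix scales the area of images by `|det|`. -/
lemma volume_toLin_image (A : Matrix (Fin 2) (Fin 2) ℝ) (s : Set (ℝ × ℝ)) :
    volume (Matrix.toLin (Module.Basis.finTwoProd ℝ) (Module.Basis.finTwoProd ℝ) A '' s) =
      ENNReal.ofReal |A.det| * volume s := by
  rw [Measure.addHaar_image_linearMap, LinearMap.det_toLin]

/-- A linear map of the plane given by a matrix of determinant `±1` preserves the area of
preimages. -/
lemma volume_toLin_preimage (A : Matrix (Fin 2) (Fin 2) ℝ) (hA : |A.det| = 1)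
    (s : Set (ℝ × ℝ)) :
    volume (Matrix.toLin (Module.Basis.finTwoProd ℝ) (Module.Basis.finTwoProd ℝ) A ⁻¹' s) =
      volume s := by
  have h : A.det ≠ 0 := by
    intro h
    simp [h] at hA
  rw [Measure.addHaar_preimage_linearMap _ (by rwa [LinearMap.det_toLin]), LinearMap.det_toLin,
    abs_inv, hA]
  simp

/-- A set containing all translates of an axis-parallel square along a segment with direction
`(a, b)` in the first quadrant contains the open square together with the two disjoint
parallelograms swept by its right and top edges. -/
lemma le_volume_of_square_sweep {w a b : ℝ} (hw : 0 < w) (ha : 0 ≤ a) (hb : 0 ≤ b)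
    {T : Set (ℝ × ℝ)}
    (hT : ∀ t ∈ Set.Icc (0 : ℝ) 1, ∀ u ∈ Set.Icc (-(w / 2)) (w / 2),
      ∀ v ∈ Set.Icc (-(w / 2)) (w / 2), (t * a + u, t * b + v) ∈ T) :
    ENNReal.ofReal (w * (a + b) + w ^ 2) ≤ volume T := by
  let I : Set ℝ := Set.Ioo (-(w / 2)) (w / 2)
  let F (A : Matrix (Fin 2) (Fin 2) ℝ) (c : ℝ × ℝ) : Set (ℝ × ℝ) :=
    (fun z ↦ c + z) ''
      (Matrix.toLin (Module.Basis.finTwoProd ℝ) (Module.Basis.finTwoProd ℝ) A ''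
        (Set.Icc 0 1 ×ˢ I))
  have hFv (A c) : volume (F A c) = ENNReal.ofReal (|A.det| * w) := by
    simp only [F, I, Set.image_add_left, measure_preimage_add]
    rw [volume_toLin_image, Measure.volume_eq_prod, Measure.prod_prod, Real.volume_Icc,
      Real.volume_Ioo, ENNReal.ofReal_mul (abs_nonneg _)]
    norm_num
  have hFm (A c) : NullMeasurableSet (F A c) volume := by
    refine Convex.nullMeasurableSet _ ?_
    exact (((convex_Icc _ _).prod (convex_Ioo _ _)).linear_image _).translate _
  set V := F !![a, 0; b, 1] (w / 2, 0)
  set H := F !![a, 1; b, 0] (0, w / 2)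
  have hVmem {z} (hz : z ∈ V) : ∃ t ∈ Set.Icc (0 : ℝ) 1, ∃ v ∈ I,
      z = (t * a + w / 2, t * b + v) := by
    obtain ⟨_, ⟨⟨t, v⟩, ⟨ht, hv⟩, rfl⟩, rfl⟩ := hz
    refine ⟨t, ht, v, hv, ?_⟩
    simp [Matrix.toLin_finTwoProd_apply]
    constructor <;> ring
  have hHmem {z} (hz : z ∈ H) : ∃ t ∈ Set.Icc (0 : ℝ) 1, ∃ u ∈ I,
      z = (t * a + u, t * b + w / 2) := by
    obtain ⟨_, ⟨⟨t, v⟩, ⟨ht, hv⟩, rfl⟩, rfl⟩ := hz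
    refine ⟨t, ht, v, hv, ?_⟩
    simp [Matrix.toLin_finTwoProd_apply]
    constructor <;> ring
  have hVH : Disjoint V H := by
    rw [Set.disjoint_left]
    intro z hz hz'
    obtain ⟨t, ht, v, hv, rfl⟩ := hVmem hz
    obtain ⟨t', ht', u, hu, h⟩ := hHmem hz'
    obtain ⟨h1, h2⟩ := Prod.mk.inj h
    have h3 : 0 < (t' - t) * a := by linarith [hu.2]
    have h4 : 0 < (t - t') * b := by linarith [hv.2]
    linarith [pos_of_mul_pos_left h3 ha, pos_of_mul_pos_left h4 hb]
  have hQ : Disjoint (I ×ˢ I) (V ∪ H) := by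
    rw [Set.disjoint_left]
    rintro z ⟨hz1, hz2⟩ (hz | hz)
    · obtain ⟨t, ht, v, hv, rfl⟩ := hVmem hz
      have := mul_nonneg ht.1 ha
      linarith [hz1.2]
    · obtain ⟨t, ht, v, hv, rfl⟩ := hHmem hz
      have := mul_nonneg ht.1 hb
      linarith [hz2.2]
  have hsub : I ×ˢ I ∪ (V ∪ H) ⊆ T := by
    rintro z (hz | hz | hz)
    · simpa using hT 0 (by simp) z.1 (Set.Ioo_subset_Icc_self hz.1) z.2
        (Set.Ioo_subset_Icc_self hz.2)
    · obtain ⟨t, ht, v, hv, rfl⟩ := hVmem hz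
      exact hT t ht _ ⟨by linarith, le_rfl⟩ v (Set.Ioo_subset_Icc_self hv)
    · obtain ⟨t, ht, v, hv, rfl⟩ := hHmem hz
      exact hT t ht v (Set.Ioo_subset_Icc_self hv) _ ⟨by linarith, le_rfl⟩
  refine le_trans (le_of_eq ?_) (measure_mono hsub)
  rw [measure_union₀ ((hFm _ _).union (hFm _ _)) hQ.aedisjoint,
    measure_union₀ (hFm _ _) hVH.aedisjoint, hFv, hFv, Measure.volume_eq_prod,
    Measure.prod_prod, Real.volume_Ioo, ← ENNReal.ofReal_mul (by linarith),
    ← ENNReal.ofReal_add (by positivity) (by positivity),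
    ← ENNReal.ofReal_add (by nlinarith) (by positivity)]
  simp only [Matrix.det_fin_two_of, mul_one, mul_zero, sub_zero, zero_sub, one_mul, zero_mul,
    abs_neg, abs_of_nonneg ha, abs_of_nonneg hb]
  congr 1
  ring

/-- Every real number is its absolute value times a sign. -/
lemma exists_abs_eq_one_eq_mul_abs (x : ℝ) : ∃ s : ℝ, |s| = 1 ∧ x = s * |x| := by
  rcases abs_choice x with h | h
  · exact ⟨1, by simp, by rw [h]; ring⟩
  · exact ⟨-1, by simp, by rw [h]; ring⟩

/-- `μ₂(L_{[p,q]} ⊕ R_{w,θ,0}) ≥ w ‖p - q‖ + w²`. -/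
theorem stmt8 (w θ : ℝ) (hw : 0 < w) (p q : ℝ × ℝ) :
    ENNReal.ofReal (w * norm2 (p - q) + w ^ 2) ≤
      volume (segment ℝ p q + reflSquare w θ) := by
  have hcs := Real.sin_sq_add_cos_sq θ
  set c := Real.cos θ with hc
  set n := Real.sin θ with hn
  set a := (q.1 - p.1) * c + (q.2 - p.2) * n with ha
  set b := (q.2 - p.2) * c - (q.1 - p.1) * n with hb
  obtain ⟨s, hs, has⟩ := exists_abs_eq_one_eq_mul_abs a
  obtain ⟨r, hr, hbr⟩ := exists_abs_eq_one_eq_mul_abs b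
  have hnorm : norm2 (p - q) ≤ |a| + |b| := by
    refine Real.sqrt_le_iff.mpr ⟨by positivity, ?_⟩
    have h : (p - q).1 ^ 2 + (p - q).2 ^ 2 = a ^ 2 + b ^ 2 := by
      simp only [ha, hb, Prod.fst_sub, Prod.snd_sub]
      linear_combination (-(q.1 - p.1) ^ 2 - (q.2 - p.2) ^ 2) * hcs
    rw [h, ← sq_abs a, ← sq_abs b]
    nlinarith [abs_nonneg a, abs_nonneg b]
  have hmem {e u : ℝ} (he : |e| = 1) (hu : u ∈ Set.Icc (-(w / 2)) (w / 2)) :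
      e * u ∈ Set.Icc (-(w / 2)) (w / 2) := by
    rw [Set.mem_Icc, ← abs_le] at hu ⊢
    rwa [abs_mul, he, one_mul]
  have hdet : |(!![s * c, -(r * n); s * n, r * c] : Matrix (Fin 2) (Fin 2) ℝ).det| = 1 := by
    rw [Matrix.det_fin_two_of,
      show s * c * (r * c) - -(r * n) * (s * n) = s * r by linear_combination s * r * hcs,
      abs_mul, hs, hr, one_mul]
  rw [← measure_preimage_add volume p, ← volume_toLin_preimage _ hdet]
  refine le_trans (ENNReal.ofReal_le_ofReal ?_)
    (le_volume_of_square_sweep hw (abs_nonneg a) (abs_nonneg b) ?_)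
  · gcongr
  intro t ht u hu v hv
  refine Set.mem_add.mpr ⟨p + t • (q - p), ?_, rotCCW θ (s * u, r * v),
    ⟨_, ⟨hmem hs hu, hmem hr hv⟩, rfl⟩, ?_⟩
  · rw [segment_eq_image']
    exact ⟨t, ht, rfl⟩
  · rw [Matrix.toLin_finTwoProd_apply]
    ext
    · simp only [rotCCW, Prod.fst_add, Prod.smul_fst, Prod.fst_sub, smul_eq_mul, ← hc, ← hn]
      linear_combination t * c * has - t * n * hbr - t * c * ha + t * n * hb
        - t * (q.1 - p.1) * hcs
    · simp only [rotCCW, Prod.snd_add, Prod.smul_snd, Prod.snd_sub, smul_eq_mul, ← hc, ← hn]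
      linear_combination t * n * has + t * c * hbr - t * n * ha - t * c * hb
        - t * (q.2 - p.2) * hcs
end

section
/- Let d > 0, b = (−d/2, 0), m = (d/2, 0) in ℝ², λ > 0, widths w₁, …, w_{n_w} > 0, orientations θ₁, …, θ_{n_θ} ∈ (0, π/2), and W̄ = (1/n_w) Σ_{i=1}^{n_w} w_i. Define ρ(r) = exp( −(λ/(n_w n_θ)) Σ_{i=1}^{n_w} Σ_{j=1}^{n_θ} [ μ₂(L_{[b,r]} ⊕ R_{w_i,θ_j,0}) + μ₂(L_{[r,m]} ⊕ R_{w_i,θ_j,0}) ] ). Then for every r ∈ ℝ² whose first coordinate is nonnegative, ρ(r) < exp( −2 λ W̄ ‖r − m‖ ). -/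
open Real MeasureTheory Pointwise

/-- The rotated square contains the closed disc inscribed in it. -/
lemma mem_reflSquare_of_sq_add_sq_le {w θ : ℝ} (hw : 0 < w) {v : ℝ × ℝ}
    (hv : v.1 ^ 2 + v.2 ^ 2 ≤ (w / 2) ^ 2) : v ∈ reflSquare w θ := by
  have hcs := Real.sin_sq_add_cos_sq θ
  have key : (v.1 * cos θ + v.2 * sin θ) ^ 2 + (v.2 * cos θ - v.1 * sin θ) ^ 2
      = v.1 ^ 2 + v.2 ^ 2 := by
    linear_combination (v.1 ^ 2 + v.2 ^ 2) * hcs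
  refine ⟨(v.1 * cos θ + v.2 * sin θ, v.2 * cos θ - v.1 * sin θ), ⟨?_, ?_⟩, ?_⟩
  · exact abs_le.mp (abs_le_of_sq_le_sq (by nlinarith) (by positivity))
  · exact abs_le.mp (abs_le_of_sq_le_sq (by nlinarith) (by positivity))
  · ext
    · simp only [rotCCW]
      linear_combination v.1 * hcs
    · simp only [rotCCW]
      linear_combination v.2 * hcs

lemma isCompact_reflSquare (w θ : ℝ) : IsCompact (reflSquare w θ) := by
  refine (isCompact_Icc.prod isCompact_Icc).image ?_
  unfold rotCCW
  fun_prop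

lemma volume_segment_add_reflSquare_ne_top (p q : ℝ × ℝ) (w θ : ℝ) :
    volume (segment ℝ p q + reflSquare w θ) ≠ ⊤ := by
  have hseg : IsCompact (segment ℝ p q) := by
    rw [segment_eq_image]
    exact isCompact_Icc.image (by fun_prop)
  exact (hseg.add (isCompact_reflSquare w θ)).measure_lt_top.ne

lemma norm2_sq (p : ℝ × ℝ) : norm2 p ^ 2 = p.1 ^ 2 + p.2 ^ 2 :=
  Real.sq_sqrt (by positivity)

lemma exists_eq_norm2_smul_unit (v : ℝ × ℝ) :
    ∃ a c : ℝ, a ^ 2 + c ^ 2 = 1 ∧ v = (norm2 v * a, norm2 v * c) := by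
  have hsq := norm2_sq v
  by_cases h : norm2 v = 0
  · rw [h] at hsq
    refine ⟨1, 0, by norm_num, ?_⟩
    ext
    · simp only [h]; nlinarith [sq_nonneg v.1, sq_nonneg v.2]
    · simp only [h]; nlinarith [sq_nonneg v.1, sq_nonneg v.2]
  · refine ⟨v.1 / norm2 v, v.2 / norm2 v, ?_, ?_⟩
    · field_simp
      exact hsq.symm
    · ext
      · simp only; field_simp
      · simp only; field_simp

/-- Isometric linear changes of coordinates preserve planar area. -/
lemma volume_image_toLin_rotation {a c : ℝ} (h : a ^ 2 + c ^ 2 = 1) (s : Set (ℝ × ℝ)) :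
    volume (Matrix.toLin (Module.Basis.finTwoProd ℝ) (Module.Basis.finTwoProd ℝ)
      !![a, -c; c, a] '' s) = volume s := by
  have hdet : a * a + c * c = 1 := by linarith
  rw [Measure.addHaar_image_linearMap, LinearMap.det_toLin, Matrix.det_fin_two_of]
  simp [hdet]

/-- A square swept along a segment covers more area than its width times the length. -/
lemma mul_norm2_lt_volume_segment_add_reflSquare {w : ℝ} (θ : ℝ) (hw : 0 < w) (p q : ℝ × ℝ) :
    w * norm2 (q - p) < (volume (segment ℝ p q + reflSquare w θ)).toReal := by
  obtain ⟨a, c, hac, hv⟩ := exists_eq_norm2_smul_unit (q - p)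
  have hL : 0 ≤ norm2 (q - p) := Real.sqrt_nonneg _
  set L := norm2 (q - p)
  set T := Matrix.toLin (Module.Basis.finTwoProd ℝ) (Module.Basis.finTwoProd ℝ) !![a, -c; c, a]
  have hT (x : ℝ × ℝ) : T x = (a * x.1 - c * x.2, c * x.1 + a * x.2) := by
    simp [T, Matrix.toLin_finTwoProd_apply, sub_eq_add_neg]
  set A : Set (ℝ × ℝ) := Set.Icc 0 L ×ˢ Set.Icc (-(w / 2)) (w / 2)
  set B : Set (ℝ × ℝ) := Set.Ico (-(w / 4)) 0 ×ˢ Set.Icc (-(w / 4)) (w / 4)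
  have hsub : p +ᵥ T '' (A ∪ B) ⊆ segment ℝ p q + reflSquare w θ := by
    rintro _ ⟨_, ⟨x, hx, rfl⟩, rfl⟩
    rcases hx with ⟨⟨h1, h2⟩, h3, h4⟩ | ⟨⟨h1, h2⟩, h3, h4⟩
    · refine Set.mem_add.mpr ⟨p + (a * x.1, c * x.1), ?_, (-c * x.2, a * x.2), ?_, ?_⟩
      · have hq : q = p + (L * a, L * c) := by rw [← hv]; abel
        rw [segment_eq_image']
        rcases hL.eq_or_lt with h0 | h0
        · have : x.1 = 0 := by linarith
          exact ⟨0, by simp, by simp [this]⟩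
        · refine ⟨x.1 / L, ⟨by positivity, (div_le_one h0).mpr h2⟩, ?_⟩
          simp only [hv]
          ext
          · simp; field_simp
          · simp; field_simp
      · apply mem_reflSquare_of_sq_add_sq_le hw
        have : (-c * x.2) ^ 2 + (a * x.2) ^ 2 = x.2 ^ 2 := by
          linear_combination x.2 ^ 2 * hac
        simp only [this]
        nlinarith
      · simp only [hT, vadd_eq_add]
        ext
        · simp; ring
        · simp; ring
    · refine Set.mem_add.mpr ⟨p, left_mem_segment ℝ p q, T x, ?_, rfl⟩
      apply mem_reflSquare_of_sq_add_sq_le hw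
      have : (T x).1 ^ 2 + (T x).2 ^ 2 = x.1 ^ 2 + x.2 ^ 2 := by
        rw [hT]; linear_combination (x.1 ^ 2 + x.2 ^ 2) * hac
      rw [this]
      nlinarith
  have hdisj : Disjoint A B := by
    rw [Set.disjoint_left]
    rintro x ⟨⟨h1, _⟩, _⟩ ⟨⟨_, h2⟩, _⟩
    linarith
  have hvol : volume (p +ᵥ T '' (A ∪ B)) = ENNReal.ofReal (L * w + w / 4 * (w / 2)) := by
    rw [measure_vadd, volume_image_toLin_rotation hac,
      measure_union hdisj (measurableSet_Ico.prod measurableSet_Icc),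
      Measure.volume_eq_prod, Measure.prod_prod, Measure.prod_prod, Real.volume_Icc,
      Real.volume_Icc, Real.volume_Ico, Real.volume_Icc,
      ← ENNReal.ofReal_mul (by linarith), ← ENNReal.ofReal_mul (by linarith),
      ← ENNReal.ofReal_add (by nlinarith) (by nlinarith)]
    congr 1
    ring
  have hle := ENNReal.toReal_mono (volume_segment_add_reflSquare_ne_top p q w θ)
    (measure_mono (μ := volume) hsub)
  rw [hvol, ENNReal.toReal_ofReal (by positivity)] at hle
  nlinarith [mul_pos hw hw]

/-- Bound on the visibility probability: for any reflection point `r` with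
nonnegative first coordinate, `ρ(r) < exp(-2 λ W̄ ‖r - m‖)`. -/
theorem stmt9 (d lam : ℝ) (hd : 0 < d) (hlam : 0 < lam)
    (nw nθ : ℕ) (hnw : 0 < nw) (hnθ : 0 < nθ)
    (w : Fin nw → ℝ) (hw : ∀ i, 0 < w i)
    (θs : Fin nθ → ℝ) (hθs : ∀ j, θs j ∈ Set.Ioo 0 (π / 2))
    (b m : ℝ × ℝ) (hb : b = (-(d / 2), 0)) (hm : m = (d / 2, 0))
    (Wbar : ℝ) (hW : Wbar = (∑ i, w i) / nw)
    (ρ : ℝ × ℝ → ℝ)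
    (hρ : ∀ r : ℝ × ℝ, ρ r =
      Real.exp (-(lam / (nw * nθ)) *
        ∑ i, ∑ j,
          ((volume (segment ℝ b r + reflSquare (w i) (θs j))).toReal +
            (volume (segment ℝ r m + reflSquare (w i) (θs j))).toReal)))
    (r : ℝ × ℝ) (hr : 0 ≤ r.1) :
    ρ r < Real.exp (-(2 * lam * Wbar) * norm2 (r - m)) := by
  subst hb hm hW
  rw [hρ, Real.exp_lt_exp]
  set N := norm2 (r - (d / 2, 0))
  have hsymm : norm2 ((d / 2, 0) - r) = N := by
    simp only [N, norm2, Prod.fst_sub, Prod.snd_sub]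
    congr 1
    ring
  have hfar : N ≤ norm2 (r - (-(d / 2), 0)) := by
    apply Real.sqrt_le_sqrt
    simp only [Prod.fst_sub, Prod.snd_sub]
    nlinarith
  have hterm (i : Fin nw) (j : Fin nθ) : 2 * N * w i <
      (volume (segment ℝ (-(d / 2), 0) r + reflSquare (w i) (θs j))).toReal +
        (volume (segment ℝ r (d / 2, 0) + reflSquare (w i) (θs j))).toReal := by
    have h1 := mul_norm2_lt_volume_segment_add_reflSquare (θs j) (hw i) (-(d / 2), 0) r
    have h2 := mul_norm2_lt_volume_segment_add_reflSquare (θs j) (hw i) r (d / 2, 0)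
    rw [hsymm] at h2
    nlinarith [mul_le_mul_of_nonneg_left hfar (hw i).le]
  have hsum : ∑ i : Fin nw, ∑ _j : Fin nθ, 2 * N * w i <
      ∑ i, ∑ j, ((volume (segment ℝ (-(d / 2), 0) r + reflSquare (w i) (θs j))).toReal +
        (volume (segment ℝ r (d / 2, 0) + reflSquare (w i) (θs j))).toReal) :=
    have : Nonempty (Fin nw) := ⟨⟨0, hnw⟩⟩
    have : Nonempty (Fin nθ) := ⟨⟨0, hnθ⟩⟩
    Finset.sum_lt_sum_of_nonempty Finset.univ_nonempty fun i _ =>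
      Finset.sum_lt_sum_of_nonempty Finset.univ_nonempty fun j _ => hterm i j
  have hnw' : (0 : ℝ) < nw := by exact_mod_cast hnw
  have hnθ' : (0 : ℝ) < nθ := by exact_mod_cast hnθ
  have hmean : 2 * lam * ((∑ i, w i) / nw) * N =
      lam / (nw * nθ) * ∑ i : Fin nw, ∑ _j : Fin nθ, 2 * N * w i := by
    simp only [Finset.sum_const, Finset.card_univ, Fintype.card_fin, nsmul_eq_mul,
      ← Finset.mul_sum]
    field_simp
  rw [neg_mul, neg_mul, neg_lt_neg_iff, hmean]
  exact mul_lt_mul_of_pos_left hsum (by positivity)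
end

section
/- Let d > 0, m = (d/2, 0) ∈ ℝ², and θ ∈ (0, π/2). For every x ≥ (d/2) cos θ, let r(x) = R_θ⁻¹ (x, −d² sin(2θ)/(8x)), where R_θ⁻¹ is the counterclockwise rotation by θ. Then ‖r(x) − m‖ = ( x − (d/2) cos θ ) · √( 1 + d² sin²θ / (4x²) ). In particular, ‖r(x) − m‖ ≥ x − (d/2) cos θ. -/
open Real

/-- Distance from the point `r(x) = R_θ⁻¹ (x, -d² sin(2θ)/(8x))` of the first-quadrant
branch of the reflection hyperbola to the mobile `m = (d/2, 0)`:
`‖r(x) - m‖ = (x - (d/2) cos θ) √(1 + d² sin²θ/(4x²)) ≥ x - (d/2) cos θ`. -/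
theorem stmt10 (d θ : ℝ) (hd : 0 < d) (hθ1 : 0 < θ) (hθ2 : θ < π / 2)
    (m : ℝ × ℝ) (hm : m = (d / 2, 0))
    (x : ℝ) (hx : d / 2 * Real.cos θ ≤ x)
    (r : ℝ × ℝ) (hr : r = rotCCW θ (x, -(d ^ 2 * Real.sin (2 * θ)) / (8 * x))) :
    norm2 (r - m) =
        (x - d / 2 * Real.cos θ) * Real.sqrt (1 + d ^ 2 * Real.sin θ ^ 2 / (4 * x ^ 2)) ∧
      x - d / 2 * Real.cos θ ≤ norm2 (r - m) := by
  subst hm hr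
  have hc : 0 < cos θ := cos_pos_of_mem_Ioo ⟨by linarith, hθ2⟩
  have hx0 : 0 < x := lt_of_lt_of_le (by positivity) hx
  have hxc : 0 ≤ x - d / 2 * cos θ := sub_nonneg.mpr hx
  have key : norm2 (rotCCW θ (x, -(d ^ 2 * sin (2 * θ)) / (8 * x)) - (d / 2, 0)) =
      (x - d / 2 * cos θ) * √(1 + d ^ 2 * sin θ ^ 2 / (4 * x ^ 2)) := by
    rw [← Real.sqrt_sq hxc, ← Real.sqrt_mul (sq_nonneg _), norm2]
    congr 1
    have hy : -(d ^ 2 * sin (2 * θ)) / (8 * x) =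
        d * sin θ / (2 * x) * (x - d / 2 * cos θ) - d / 2 * sin θ := by
      rw [sin_two_mul]
      field_simp
      ring
    have hz : d ^ 2 * sin θ ^ 2 / (4 * x ^ 2) = (d * sin θ / (2 * x)) ^ 2 := by
      field_simp
      ring
    simp only [rotCCW, Prod.fst_sub, Prod.snd_sub]
    rw [hy, hz]
    generalize d * sin θ / (2 * x) = k
    have h1 := sin_sq_add_cos_sq θ
    set y := k * (x - d / 2 * cos θ) - d / 2 * sin θ with hy'
    have hk : k * (x - d / 2 * cos θ) = y + d / 2 * sin θ := by rw [hy']; ring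
    have : (x - d / 2 * cos θ) ^ 2 * (1 + k ^ 2) =
        (x - d / 2 * cos θ) ^ 2 + (y + d / 2 * sin θ) ^ 2 := by rw [← hk]; ring
    rw [this]
    linear_combination (x ^ 2 + y ^ 2 - d ^ 2 / 4) * h1
  refine ⟨key, ?_⟩
  rw [key]
  refine le_mul_of_one_le_right hxc (Real.one_le_sqrt.mpr ?_)
  exact le_add_of_nonneg_right (by positivity)
end

section
/- Let d > 0, b = (−d/2, 0), m = (d/2, 0) in ℝ², λ > 0, widths w₁, …, w_{n_w} > 0, orientations θ₁, …, θ_{n_θ} ∈ (0, π/2), W̄ = (1/n_w) Σ_i w_i, and ρ(r) = exp( −(λ/(n_w n_θ)) Σ_i Σ_j [ μ₂(L_{[b,r]} ⊕ R_{w_i,θ_j,0}) + μ₂(L_{[r,m]} ⊕ R_{w_i,θ_j,0}) ] ). Define λ̂ = (2 λ W̄ / n_θ) Σ_{j=1}^{n_θ} [ ∫_{(d/2)cos θ_j}^{∞} ρ( R_{θ_j}⁻¹ (x, −d² sin(2θ_j)/(8x)) ) dx + ∫_{(d/2)sin θ_j}^{∞} ρ( R_{θ_j}⁻¹ (−d²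 sin(2θ_j)/(8y), y) ) dy ]. Then λ̂ < 2; equivalently, exp(−λ̂) > e^{−2}. (λ̂ is the mean of the Poisson number V_{[d,∞]} of reflectors producing visible reflections, so under independent blocking the probability e^{−λ̂} that no reflector produces a visible reflection always exceeds e^{−2}, regardless of the density, sizes, and orientations of the reflectors.) -/
open Real MeasureTheory Pointwise

/-- A chord of length `w` through the center, in any direction, lies in the square. -/
lemma chord_mem_reflSquare {w h : ℝ} (θ φ : ℝ) (hh : |h| ≤ w / 2) :
    (-(h * Real.sin φ), h * Real.cos φ) ∈ reflSquare w θ := by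
  have key : ∀ c : ℝ, |c| ≤ 1 → h * c ∈ Set.Icc (-(w / 2)) (w / 2) := by
    intro c hc
    rw [Set.mem_Icc, ← abs_le, abs_mul]
    calc |h| * |c| ≤ |h| * 1 := by gcongr
      _ ≤ w / 2 := by simpa using hh
  refine ⟨(h * Real.sin (θ - φ), h * Real.cos (θ - φ)),
    ⟨key _ (Real.abs_sin_le_one _), key _ (Real.abs_cos_le_one _)⟩, ?_⟩
  have h1 := Real.sin_sq_add_cos_sq θ
  simp only [rotCCW, Real.sin_sub, Real.cos_sub, Prod.mk.injEq]
  constructor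
  · linear_combination (-(h * Real.sin φ)) * h1
  · linear_combination (h * Real.cos φ) * h1

lemma isCompact_segment_prod (p q : ℝ × ℝ) : IsCompact (segment ℝ p q) := by
  rw [segment_eq_image]
  exact isCompact_Icc.image (by fun_prop)

/-- The area swept by a square translated along a segment is at least the side length times
the length of the projection of the segment to any line. -/
lemma mul_abs_proj_le_volume_segment_add (w θ φ : ℝ) (p q : ℝ × ℝ) :
    w * |(q.1 - p.1) * Real.cos φ + (q.2 - p.2) * Real.sin φ| ≤
      (volume (segment ℝ p q + reflSquare w θ)).toReal := by
  have hfin : volume (segment ℝ p q + reflSquare w θ) ≠ ⊤ :=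
    ((isCompact_segment_prod p q).add (isCompact_reflSquare w θ)).measure_lt_top.ne
  let f : (ℝ × ℝ) →ₗ[ℝ] (ℝ × ℝ) :=
    Matrix.toLin (Module.Basis.finTwoProd ℝ) (Module.Basis.finTwoProd ℝ)
      !![q.1 - p.1, -Real.sin φ; q.2 - p.2, Real.cos φ]
  let S : Set (ℝ × ℝ) := Set.Icc 0 1 ×ˢ Set.Icc (-(w / 2)) (w / 2)
  have hsub : (fun z => p + z) '' (f '' S) ⊆ segment ℝ p q + reflSquare w θ := by
    rintro _ ⟨_, ⟨⟨t, h⟩, ⟨ht, hh⟩, rfl⟩, rfl⟩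
    refine Set.mem_add.2 ⟨p + t • (q - p), ?_, (-(h * Real.sin φ), h * Real.cos φ),
      chord_mem_reflSquare θ φ (abs_le.2 hh), ?_⟩
    · rw [segment_eq_image']
      exact ⟨t, ht, rfl⟩
    · simp only [f, Matrix.toLin_finTwoProd_apply]
      ext <;> simp <;> ring
  have hvol : volume ((fun z => p + z) '' (f '' S)) =
      ENNReal.ofReal (w * |(q.1 - p.1) * Real.cos φ + (q.2 - p.2) * Real.sin φ|) := by
    rw [Set.image_add_left, measure_preimage_add, Measure.addHaar_image_linearMap,
      LinearMap.det_toLin, Matrix.det_fin_two_of, Measure.volume_eq_prod, Measure.prod_prod,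
      Real.volume_Icc, Real.volume_Icc, ← ENNReal.ofReal_mul (by norm_num),
      ← ENNReal.ofReal_mul (abs_nonneg _)]
    congr 1
    rw [show (q.1 - p.1) * Real.cos φ - -Real.sin φ * (q.2 - p.2) =
      (q.1 - p.1) * Real.cos φ + (q.2 - p.2) * Real.sin φ by ring]
    ring
  rw [← ENNReal.ofReal_le_iff_le_toReal hfin, ← hvol]
  exact measure_mono hsub

/-- The blocking exponent dominates the mean width times the projected path length. -/
lemma exp_neg_sum_volume_le {lam : ℝ} (hlam : 0 < lam) {nw nθ : ℕ} (hnw : 0 < nw) (hnθ : 0 < nθ)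
    {w : Fin nw → ℝ} (hw : ∀ i, 0 < w i) (θs : Fin nθ → ℝ) (b m r : ℝ × ℝ) (φ : ℝ) {x : ℝ}
    (hx : x ≤ |(r.1 - b.1) * Real.cos φ + (r.2 - b.2) * Real.sin φ| +
      |(m.1 - r.1) * Real.cos φ + (m.2 - r.2) * Real.sin φ|) :
    Real.exp (-(lam / (nw * nθ)) *
        ∑ i, ∑ j,
          ((volume (segment ℝ b r + reflSquare (w i) (θs j))).toReal +
            (volume (segment ℝ r m + reflSquare (w i) (θs j))).toReal)) ≤
      Real.exp (-(lam * ((∑ i, w i) / nw)) * x) := by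
  have hnw' : (0 : ℝ) < nw := by exact_mod_cast hnw
  have hnθ' : (0 : ℝ) < nθ := by exact_mod_cast hnθ
  rw [Real.exp_le_exp, neg_mul, neg_mul, neg_le_neg_iff]
  have hsum : ∑ i, ∑ _j : Fin nθ, w i * x ≤ ∑ i, ∑ j,
          ((volume (segment ℝ b r + reflSquare (w i) (θs j))).toReal +
            (volume (segment ℝ r m + reflSquare (w i) (θs j))).toReal) := by
    refine Finset.sum_le_sum fun i _ => Finset.sum_le_sum fun j _ => ?_
    have h1 := mul_abs_proj_le_volume_segment_add (w i) (θs j) φ b r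
    have h2 := mul_abs_proj_le_volume_segment_add (w i) (θs j) φ r m
    have h3 := mul_le_mul_of_nonneg_left hx (hw i).le
    rw [mul_add] at h3
    linarith
  calc lam * ((∑ i, w i) / nw) * x = lam / (nw * nθ) * ∑ i, ∑ _j : Fin nθ, w i * x := by
        simp only [Finset.sum_const, Finset.card_univ, Fintype.card_fin, nsmul_eq_mul,
          ← Finset.mul_sum, ← Finset.sum_mul]
        field_simp
    _ ≤ _ := by gcongr

lemma setIntegral_Ici_lt_inv_of_le_exp {f : ℝ → ℝ} {a c : ℝ} (ha : 0 < a) (hc : 0 < c)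
    (hf0 : ∀ x, 0 ≤ f x) (hf : ∀ x, f x ≤ Real.exp (-a * x)) :
    ∫ x in Set.Ici c, f x < 1 / a := by
  rw [integral_Ici_eq_integral_Ioi]
  have hna : -a < 0 := neg_lt_zero.2 ha
  calc ∫ x in Set.Ioi c, f x ≤ ∫ x in Set.Ioi c, Real.exp (-a * x) :=
        integral_mono_of_nonneg (Filter.Eventually.of_forall hf0)
          (integrableOn_exp_mul_Ioi hna c) (Filter.Eventually.of_forall hf)
    _ = Real.exp (-a * c) / a := by rw [integral_exp_mul_Ioi hna, neg_div_neg_eq]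
    _ < 1 / a := by
        have : Real.exp (-a * c) < 1 := Real.exp_lt_one_iff.2 (mul_neg_of_neg_of_pos hna hc)
        gcongr

/-- Corollary 1 (lower bound on the probability of no visible reflections): the mean
`λ̂` of the Poisson number of reflectors producing visible reflections satisfies
`λ̂ < 2`, equivalently `exp(-λ̂) > e⁻²`, regardless of the density, sizes, and
orientations of the reflectors. -/
theorem stmt12 (d lam : ℝ) (hd : 0 < d) (hlam : 0 < lam)
    (nw nθ : ℕ) (hnw : 0 < nw) (hnθ : 0 < nθ)
    (w : Fin nw → ℝ) (hw : ∀ i, 0 < w i)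
    (θs : Fin nθ → ℝ) (hθs : ∀ j, θs j ∈ Set.Ioo 0 (π / 2))
    (b m : ℝ × ℝ) (hb : b = (-(d / 2), 0)) (hm : m = (d / 2, 0))
    (Wbar : ℝ) (hW : Wbar = (∑ i, w i) / nw)
    (ρ : ℝ × ℝ → ℝ)
    (hρ : ∀ r : ℝ × ℝ, ρ r =
      Real.exp (-(lam / (nw * nθ)) *
        ∑ i, ∑ j,
          ((volume (segment ℝ b r + reflSquare (w i) (θs j))).toReal +
            (volume (segment ℝ r m + reflSquare (w i) (θs j))).toReal)))
    (lamhat : ℝ)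
    (hlamhat : lamhat = (2 * lam * Wbar / nθ) *
      ∑ j,
        ((∫ x in Set.Ici (d / 2 * Real.cos (θs j)),
            ρ (rotCCW (θs j) (x, -(d ^ 2 * Real.sin (2 * θs j)) / (8 * x)))) +
          (∫ y in Set.Ici (d / 2 * Real.sin (θs j)),
            ρ (rotCCW (θs j) (-(d ^ 2 * Real.sin (2 * θs j)) / (8 * y), y))))) :
    lamhat < 2 ∧ Real.exp (-lamhat) > Real.exp (-2) := by
  have hnw' : (0 : ℝ) < nw := by exact_mod_cast hnw
  have hnθ' : (0 : ℝ) < nθ := by exact_mod_cast hnθ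
  have : Nonempty (Fin nw) := ⟨⟨0, hnw⟩⟩
  have : Nonempty (Fin nθ) := ⟨⟨0, hnθ⟩⟩
  have hWpos : 0 < Wbar := by
    rw [hW]
    exact div_pos (Finset.sum_pos (fun i _ => hw i) Finset.univ_nonempty) hnw'
  have ha : 0 < 2 * lam * Wbar := by positivity
  have hρ0 : ∀ r, 0 ≤ ρ r := fun r => by rw [hρ]; positivity
  have hρle : ∀ (r : ℝ × ℝ) (φ x : ℝ),
      2 * x ≤ |(r.1 - b.1) * Real.cos φ + (r.2 - b.2) * Real.sin φ| +
        |(m.1 - r.1) * Real.cos φ + (m.2 - r.2) * Real.sin φ| →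
      ρ r ≤ Real.exp (-(2 * lam * Wbar) * x) := by
    intro r φ x hx
    rw [hρ, show -(2 * lam * Wbar) * x = -(lam * ((∑ i, w i) / nw)) * (2 * x) by rw [hW]; ring]
    exact exp_neg_sum_volume_le hlam hnw hnθ hw θs b m r φ hx
  have hterm : ∀ j ∈ Finset.univ,
      ((∫ x in Set.Ici (d / 2 * Real.cos (θs j)),
            ρ (rotCCW (θs j) (x, -(d ^ 2 * Real.sin (2 * θs j)) / (8 * x)))) +
          (∫ y in Set.Ici (d / 2 * Real.sin (θs j)),
            ρ (rotCCW (θs j) (-(d ^ 2 * Real.sin (2 * θs j)) / (8 * y), y)))) <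
      2 / (2 * lam * Wbar) := by
    intro j _
    obtain ⟨h0, h1⟩ := hθs j
    have hcos : 0 < Real.cos (θs j) := Real.cos_pos_of_mem_Ioo ⟨by linarith, h1⟩
    have hsin : 0 < Real.sin (θs j) := Real.sin_pos_of_pos_of_lt_pi h0 (by linarith)
    have hsq := Real.sin_sq_add_cos_sq (θs j)
    have hX := setIntegral_Ici_lt_inv_of_le_exp ha (mul_pos (half_pos hd) hcos)
      (f := fun x => ρ (rotCCW (θs j) (x, -(d ^ 2 * Real.sin (2 * θs j)) / (8 * x))))
      (fun _ => hρ0 _) (fun x => by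
        apply hρle _ (θs j)
        simp only [rotCCW, hb, hm]
        generalize -(d ^ 2 * Real.sin (2 * θs j)) / (8 * x) = y
        refine le_trans (le_of_eq ?_) (add_le_add (le_abs_self _) (neg_le_abs _))
        linear_combination (-2 * x) * hsq)
    have hY := setIntegral_Ici_lt_inv_of_le_exp ha (mul_pos (half_pos hd) hsin)
      (f := fun y => ρ (rotCCW (θs j) (-(d ^ 2 * Real.sin (2 * θs j)) / (8 * y), y)))
      (fun _ => hρ0 _) (fun y => by
        apply hρle _ (θs j + π / 2)
        simp only [rotCCW, hb, hm, Real.cos_add_pi_div_two, Real.sin_add_pi_div_two]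
        generalize -(d ^ 2 * Real.sin (2 * θs j)) / (8 * y) = x
        refine le_trans (le_of_eq ?_) (add_le_add (le_abs_self _) (neg_le_abs _))
        linear_combination (-2 * y) * hsq)
    rw [show 2 / (2 * lam * Wbar) = 1 / (2 * lam * Wbar) + 1 / (2 * lam * Wbar) by ring]
    exact add_lt_add hX hY
  have hlt : lamhat < 2 := by
    have hsum := Finset.sum_lt_sum_of_nonempty Finset.univ_nonempty hterm
    rw [hlamhat]
    calc _ < (2 * lam * Wbar / nθ) * ∑ _j : Fin nθ, 2 / (2 * lam * Wbar) :=
          mul_lt_mul_of_pos_left hsum (div_pos ha hnθ')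
      _ = 2 := by
          simp only [Finset.sum_const, Finset.card_univ, Fintype.card_fin, nsmul_eq_mul]
          field_simp
  exact ⟨hlt, Real.exp_lt_exp.2 (neg_lt_neg hlt)⟩
end

section
/- Let d > 0, θ ∈ (0, π/2), and d ≤ s < ∞. With h_I(s) = (√z₁, (v/u)√(u² − z₁)) and h_II(s) = (−√z₂, (v/u)√(u² − z₂)), where z₁ = s⁴ cot²θ / (4(s² csc²θ − d²)), z₂ = s⁴ tan²θ / (4(s² sec²θ − d²)), u = s/2, v = √(s² − d²)/2, and R_θ the clockwise rotation by θ, the following hold: the first coordinate of R_θ h_I(s) equals (1/2)√(s² − d² sin²θ), and the second coordinate of R_θ h_II(s) equals (1/2)√(s² − d² cos²θ). Moreover the first coordinate of R_θ m equals (d/2) cos θ and the second coordinate of R_θ b equals (d/2) sin θ. -/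
open Real

/-- Clockwise rotation `R_θ = [[cos θ, sin θ], [-sin θ, cos θ]]` on `ℝ × ℝ`. -/
noncomputable def rotCW (θ : ℝ) (p : ℝ × ℝ) : ℝ × ℝ :=
  (p.1 * Real.cos θ + p.2 * Real.sin θ, -p.1 * Real.sin θ + p.2 * Real.cos θ)

/-- The reflection point combined with a unit vector `(x, y)` in the open first quadrant:
the square roots evaluate to `s² x / (2W)` and `(s² - d²) y / (2W)`, where `W = √(s² - d² y²)`. -/
theorem boundary_point_combination {d s x y z : ℝ} (hd : 0 < d) (hs : d ≤ s) (hx : 0 < x)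
    (hy : 0 < y) (hxy : y ^ 2 + x ^ 2 = 1)
    (hz : z = s ^ 4 * (x / y) ^ 2 / (4 * (s ^ 2 * (1 / y) ^ 2 - d ^ 2))) :
    √z * x + √(s ^ 2 - d ^ 2) / 2 / (s / 2) * √((s / 2) ^ 2 - z) * y =
      1 / 2 * √(s ^ 2 - d ^ 2 * y ^ 2) := by
  have hs0 : 0 < s := hd.trans_le hs
  have hds : 0 ≤ s ^ 2 - d ^ 2 := sub_nonneg.2 (pow_le_pow_left₀ hd.le hs 2)
  have hpos : 0 < s ^ 2 - d ^ 2 * y ^ 2 := by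
    have h : 0 < d ^ 2 * x ^ 2 := by positivity
    linear_combination h + hds + d ^ 2 * hxy
  set W := √(s ^ 2 - d ^ 2 * y ^ 2) with hW
  have hW0 : 0 < W := Real.sqrt_pos.2 hpos
  have hW2 : W ^ 2 = s ^ 2 - d ^ 2 * y ^ 2 := Real.sq_sqrt hpos.le
  set V := √(s ^ 2 - d ^ 2) with hV
  have hV0 : 0 ≤ V := Real.sqrt_nonneg _
  have hV2 : V ^ 2 = s ^ 2 - d ^ 2 := Real.sq_sqrt hds
  have hz' : z = (s ^ 2 * x / (2 * W)) ^ 2 := by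
    have h : s ^ 2 * (1 / y) ^ 2 - d ^ 2 = W ^ 2 / y ^ 2 := by
      rw [hW2]; field_simp
    rw [hz, h]; field_simp; norm_num
  have hcompl : (s / 2) ^ 2 - z = (s * y * V / (2 * W)) ^ 2 := by
    rw [hz']; field_simp; rw [hW2, hV2]; linear_combination (-s ^ 2) * hxy
  rw [hcompl, hz', Real.sqrt_sq (by positivity), Real.sqrt_sq (by positivity)]
  field_simp
  rw [hW2, hV2]; linear_combination s ^ 2 * hxy

/-- Rotated coordinates of the boundary potential reflection points and of the base
station and mobile: `[R_θ h_I(s)]₁ = (1/2)√(s² - d² sin²θ)`,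
`[R_θ h_II(s)]₂ = (1/2)√(s² - d² cos²θ)`, `[R_θ m]₁ = (d/2) cos θ`,
`[R_θ b]₂ = (d/2) sin θ`. -/
theorem stmt13 (d θ s : ℝ) (hd : 0 < d) (hθ1 : 0 < θ) (hθ2 : θ < π / 2) (hs : d ≤ s)
    (u v z1 z2 : ℝ) (hu : u = s / 2) (hv : v = Real.sqrt (s ^ 2 - d ^ 2) / 2)
    (hz1 : z1 = s ^ 4 * Real.cot θ ^ 2 / (4 * (s ^ 2 * (1 / Real.sin θ) ^ 2 - d ^ 2)))
    (hz2 : z2 = s ^ 4 * Real.tan θ ^ 2 / (4 * (s ^ 2 * (1 / Real.cos θ) ^ 2 - d ^ 2)))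
    (hI hII b m : ℝ × ℝ)
    (hhI : hI = (Real.sqrt z1, v / u * Real.sqrt (u ^ 2 - z1)))
    (hhII : hII = (-Real.sqrt z2, v / u * Real.sqrt (u ^ 2 - z2)))
    (hb : b = (-(d / 2), 0)) (hm : m = (d / 2, 0)) :
    (rotCW θ hI).1 = 1 / 2 * Real.sqrt (s ^ 2 - d ^ 2 * Real.sin θ ^ 2) ∧
      (rotCW θ hII).2 = 1 / 2 * Real.sqrt (s ^ 2 - d ^ 2 * Real.cos θ ^ 2) ∧
      (rotCW θ m).1 = d / 2 * Real.cos θ ∧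
      (rotCW θ b).2 = d / 2 * Real.sin θ := by
  have hsin : 0 < Real.sin θ := Real.sin_pos_of_pos_of_lt_pi hθ1 (by linarith [Real.pi_pos])
  have hcos : 0 < Real.cos θ := Real.cos_pos_of_mem_Ioo ⟨by linarith, hθ2⟩
  rw [Real.cot_eq_cos_div_sin] at hz1
  rw [Real.tan_eq_sin_div_cos] at hz2
  subst hu hv hhI hhII hb hm
  refine ⟨?_, ?_, ?_, ?_⟩
  · exact boundary_point_combination hd hs hcos hsin (Real.sin_sq_add_cos_sq θ) hz1
  · simpa [rotCW] using
      boundary_point_combination hd hs hsin hcos (Real.cos_sq_add_sin_sq θ) hz2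
  · simp [rotCW]
  · simp [rotCW]
end

section
/- Let d > 0, λ > 0, W̄ > 0, and θ₁, …, θ_{n_θ} ∈ (0, π/2). Define, for s ∈ [d, ∞), F(s) = 1 − exp( −(λ W̄ / n_θ) Σ_{j=1}^{n_θ} [ √(s² − d² sin²θ_j) − d(sin θ_j + cos θ_j) + √(s² − d² cos²θ_j) ] ). Then F(d) = 0, F is continuous and strictly increasing on [d, ∞), lim_{s→∞} F(s) = 1, and for every s ∈ (d, ∞), F is differentiable at s with derivative F′(s) = (λ W̄ s / n_θ) · Σ_{j=1}^{n_θ} [ 1/√(s² − d² sin²θ_j) + 1/√(s² − d² cos²θ_j) ] · exp( −(λ W̄ / n_θ) Σ_{j=1}^{n_θ} [ √(s² − d² sin²θ_j) − d(sin θ_j + cos θ_j) + √(s² − d² cos²θ_j) ] ). (Thus F is the cumulative distribution function, and F′ the probability density, of the path length S₍₁₎ of the first-arriving single-bounce reflection under the Boolean model without blocking.) -/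
open Real

lemma strictMonoOn_sqrt_sq_sub {c d : ℝ} (hd : 0 ≤ d) (hc : c ≤ d ^ 2) :
    StrictMonoOn (fun s : ℝ => √(s ^ 2 - c)) (Set.Ici d) := by
  intro x hx y _ hxy
  have hx : d ≤ x := hx
  exact Real.sqrt_lt_sqrt (by nlinarith) (by nlinarith)

lemma tendsto_sqrt_sq_sub_atTop (c : ℝ) :
    Filter.Tendsto (fun s : ℝ => √(s ^ 2 - c)) Filter.atTop Filter.atTop :=
  Real.tendsto_sqrt_atTop.comp <|
    Filter.tendsto_atTop_add_const_right _ (-c) (Filter.tendsto_pow_atTop two_ne_zero)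

lemma hasDerivAt_sqrt_sq_sub {c s : ℝ} (hc : c < s ^ 2) :
    HasDerivAt (fun s : ℝ => √(s ^ 2 - c)) (s * (1 / √(s ^ 2 - c))) s := by
  have h := ((hasDerivAt_pow 2 s).sub_const c).sqrt (sub_pos.2 hc).ne'
  refine h.congr_deriv ?_
  push_cast
  ring

/-- Corollary 2 (distribution of `S₍₁₎` without blocking): the function
`F(s) = 1 - exp(-(λ W̄ / n_θ) Σⱼ [√(s² - d² sin²θⱼ) - d(sin θⱼ + cos θⱼ) + √(s² - d² cos²θⱼ)])`
is a CDF on `[d, ∞)`: `F(d) = 0`, `F` is continuous and strictly increasing on `[d, ∞)`,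
`F(s) → 1` as `s → ∞`, and on `(d, ∞)` its derivative is the stated density. -/
theorem stmt14 (d lam Wbar : ℝ) (hd : 0 < d) (hlam : 0 < lam) (hW : 0 < Wbar)
    (nθ : ℕ) (hnθ : 0 < nθ) (θs : Fin nθ → ℝ) (hθs : ∀ j, θs j ∈ Set.Ioo 0 (π / 2))
    (F : ℝ → ℝ)
    (hF : ∀ s : ℝ, F s = 1 -
      Real.exp (-(lam * Wbar / nθ) *
        ∑ j, (Real.sqrt (s ^ 2 - d ^ 2 * Real.sin (θs j) ^ 2) -
          d * (Real.sin (θs j) + Real.cos (θs j)) +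
          Real.sqrt (s ^ 2 - d ^ 2 * Real.cos (θs j) ^ 2)))) :
    F d = 0 ∧
      ContinuousOn F (Set.Ici d) ∧
      StrictMonoOn F (Set.Ici d) ∧
      Filter.Tendsto F Filter.atTop (nhds 1) ∧
      ∀ s : ℝ, d < s →
        HasDerivAt F
          (lam * Wbar * s / nθ *
            (∑ j, (1 / Real.sqrt (s ^ 2 - d ^ 2 * Real.sin (θs j) ^ 2) +
              1 / Real.sqrt (s ^ 2 - d ^ 2 * Real.cos (θs j) ^ 2))) *
            Real.exp (-(lam * Wbar / nθ) *
              ∑ j, (Real.sqrt (s ^ 2 - d ^ 2 * Real.sin (θs j) ^ 2) -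
                d * (Real.sin (θs j) + Real.cos (θs j)) +
                Real.sqrt (s ^ 2 - d ^ 2 * Real.cos (θs j) ^ 2)))) s := by
  obtain rfl : F = _ := funext hF
  have hn : (0 : ℝ) < nθ := by exact_mod_cast hnθ
  have hk : 0 < lam * Wbar / nθ := by positivity
  have : Nonempty (Fin nθ) := ⟨⟨0, hnθ⟩⟩
  have hsin : ∀ j, 0 < sin (θs j) := fun j =>
    sin_pos_of_pos_of_lt_pi (hθs j).1 (by linarith [(hθs j).2, pi_pos])
  have hcos : ∀ j, 0 < cos (θs j) := fun j =>
    cos_pos_of_mem_Ioo ⟨by linarith [(hθs j).1, pi_pos], (hθs j).2⟩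
  have hsin_le : ∀ j, d ^ 2 * sin (θs j) ^ 2 ≤ d ^ 2 := fun j =>
    mul_le_of_le_one_right (sq_nonneg d) (sin_sq_le_one _)
  have hcos_le : ∀ j, d ^ 2 * cos (θs j) ^ 2 ≤ d ^ 2 := fun j =>
    mul_le_of_le_one_right (sq_nonneg d) (cos_sq_le_one _)
  refine ⟨?_, ?_, ?_, ?_, ?_⟩
  · have hterm : ∀ j, √(d ^ 2 - d ^ 2 * sin (θs j) ^ 2) - d * (sin (θs j) + cos (θs j)) +
        √(d ^ 2 - d ^ 2 * cos (θs j) ^ 2) = 0 := by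
      intro j
      have h₁ : d ^ 2 - d ^ 2 * sin (θs j) ^ 2 = (d * cos (θs j)) ^ 2 := by
        rw [sin_sq]; ring
      have h₂ : d ^ 2 - d ^ 2 * cos (θs j) ^ 2 = (d * sin (θs j)) ^ 2 := by
        rw [cos_sq']; ring
      rw [h₁, h₂, sqrt_sq (mul_pos hd (hcos j)).le, sqrt_sq (mul_pos hd (hsin j)).le]
      ring
    simp [hterm]
  · fun_prop
  · intro x hx y hy hxy
    refine sub_lt_sub_left (exp_lt_exp.2 ?_) 1
    refine mul_lt_mul_of_neg_left ?_ (neg_lt_zero.2 hk)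
    refine Finset.sum_lt_sum_of_nonempty Finset.univ_nonempty fun j _ => ?_
    have h₁ := strictMonoOn_sqrt_sq_sub hd.le (hsin_le j) hx hy hxy
    have h₂ := strictMonoOn_sqrt_sq_sub hd.le (hcos_le j) hx hy hxy
    exact add_lt_add (sub_lt_sub_right h₁ _) h₂
  · have hsum : Filter.Tendsto (fun s : ℝ => ∑ j, (√(s ^ 2 - d ^ 2 * sin (θs j) ^ 2) -
        d * (sin (θs j) + cos (θs j)) + √(s ^ 2 - d ^ 2 * cos (θs j) ^ 2)))
        Filter.atTop Filter.atTop := by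
      simp only [Finset.sum_add_distrib, Finset.sum_sub_distrib]
      have hsqrt : ∀ c : Fin nθ → ℝ, Filter.Tendsto (fun s : ℝ => ∑ j, √(s ^ 2 - c j))
          Filter.atTop Filter.atTop := fun c =>
        Filter.tendsto_atTop_mono
          (fun s => Finset.single_le_sum (f := fun j => √(s ^ 2 - c j))
            (fun j _ => sqrt_nonneg _) (Finset.mem_univ ⟨0, hnθ⟩))
          (tendsto_sqrt_sq_sub_atTop (c ⟨0, hnθ⟩))
      exact (Filter.tendsto_atTop_add_const_right _ _ (hsqrt _)).atTop_add_atTop (hsqrt _)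
    have h := tendsto_exp_atBot.comp (hsum.const_mul_atTop_of_neg (neg_lt_zero.2 hk))
    simpa using h.const_sub 1
  · intro s hs
    have hds : d ^ 2 < s ^ 2 := by nlinarith
    have hsum := HasDerivAt.fun_sum (u := Finset.univ) fun j _ =>
      ((hasDerivAt_sqrt_sq_sub ((hsin_le j).trans_lt hds)).sub_const
        (d * (sin (θs j) + cos (θs j)))).add
        (hasDerivAt_sqrt_sq_sub ((hcos_le j).trans_lt hds))
    have h := ((hsum.const_mul (-(lam * Wbar / nθ))).exp).const_sub 1
    refine h.congr_deriv ?_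
    simp only [← mul_add, ← Finset.mul_sum, Pi.add_apply]
    ring
end

section
/- Let d > 0, m = (d/2, 0), θ ∈ (0, π/2), and s > d. Let h = h_I(s) = (√z₁, (v/u)√(u² − z₁)) with z₁ = s⁴ cot²θ / (4(s² csc²θ − d²)), u = s/2, v = √(s² − d²)/2, and let α = arccos(−d sin θ / s) + θ − π/2. Then h ≠ m and (h − m)/‖h − m‖ = (cos α, sin α); that is, the reflected path from the first-quadrant boundary potential reflection point h_I(s) arrives at the mobile from direction angle ψ_I(s) = arccos(−d sin θ / s) + θ − π/2, measured counterclockwise from the positive x-axis. -/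
open Real

/-- A positive multiple of the unit vector `(cos α, sin α)` is nonzero and normalizes to it. -/
theorem ne_and_normalize_of_sub_eq_polar {h m : ℝ × ℝ} {r α : ℝ} (hr : 0 < r)
    (h₁ : h.1 - m.1 = r * Real.cos α) (h₂ : h.2 - m.2 = r * Real.sin α) :
    h ≠ m ∧
      ((h.1 - m.1) / norm2 (h - m), (h.2 - m.2) / norm2 (h - m)) =
        (Real.cos α, Real.sin α) := by
  have hr0 : r ≠ 0 := hr.ne'
  have hn : norm2 (h - m) = r := by
    rw [norm2, Prod.fst_sub, Prod.snd_sub, h₁, h₂,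
      show (r * Real.cos α) ^ 2 + (r * Real.sin α) ^ 2 = r ^ 2 by
        linear_combination r ^ 2 * Real.sin_sq_add_cos_sq α,
      Real.sqrt_sq hr.le]
  refine ⟨?_, ?_⟩
  · rintro rfl
    have : norm2 (h - h) = 0 := by simp [norm2]
    linarith
  · rw [hn, h₁, h₂, mul_div_cancel_left₀ _ hr0, mul_div_cancel_left₀ _ hr0]

/-- The reflected path from the first-quadrant boundary potential reflection point
`h = h_I(s)` arrives at the mobile `m = (d/2, 0)` from direction angle
`ψ_I(s) = arccos(-d sin θ / s) + θ - π/2`: `h ≠ m` and the unit vector from `m`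
toward `h` is `(cos α, sin α)` with `α = ψ_I(s)`. -/
theorem stmt19 (d θ s : ℝ) (hd : 0 < d) (hθ1 : 0 < θ) (hθ2 : θ < π / 2) (hs : d < s)
    (u v z1 α : ℝ) (hu : u = s / 2) (hv : v = Real.sqrt (s ^ 2 - d ^ 2) / 2)
    (hz1 : z1 = s ^ 4 * Real.cot θ ^ 2 / (4 * (s ^ 2 * (1 / Real.sin θ) ^ 2 - d ^ 2)))
    (hα : α = Real.arccos (-(d * Real.sin θ) / s) + θ - π / 2)
    (h m : ℝ × ℝ)
    (hh : h = (Real.sqrt z1, v / u * Real.sqrt (u ^ 2 - z1)))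
    (hm : m = (d / 2, 0)) :
    h ≠ m ∧
      ((h.1 - m.1) / norm2 (h - m), (h.2 - m.2) / norm2 (h - m)) =
        (Real.cos α, Real.sin α) := by
  have hs0 : 0 < s := hd.trans hs
  have hS : 0 < Real.sin θ := Real.sin_pos_of_pos_of_lt_pi hθ1 (by linarith [Real.pi_pos])
  have hC : 0 < Real.cos θ := Real.cos_pos_of_mem_Ioo ⟨by linarith, hθ2⟩
  have hSC := Real.sin_sq_add_cos_sq θ
  have hcos : Real.cos α = Real.sin (Real.arccos (-(d * Real.sin θ) / s) + θ) := by
    rw [hα, Real.cos_sub_pi_div_two]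
  have hsin : Real.sin α = -Real.cos (Real.arccos (-(d * Real.sin θ) / s) + θ) := by
    rw [hα, Real.sin_sub_pi_div_two]
  rw [Real.sin_add, Real.sin_arccos] at hcos
  rw [Real.cos_add, Real.sin_arccos] at hsin
  rw [Real.cot_eq_cos_div_sin] at hz1
  clear hα
  generalize Real.sin θ = S at *
  generalize Real.cos θ = C at *
  have hS1 : S < 1 := by nlinarith
  have hdS : d * S < s := by nlinarith
  have hdS0 : 0 < d * S := mul_pos hd hS
  have harccos : Real.cos (Real.arccos (-(d * S) / s)) = -(d * S) / s := by
    apply Real.cos_arccos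
    · rw [le_div_iff₀ hs0]; linarith
    · rw [div_le_iff₀ hs0]; linarith
  rw [harccos] at hcos hsin
  have hW2 : 0 < s ^ 2 - (d * S) ^ 2 := by nlinarith
  have hq2 : 0 < s ^ 2 - d ^ 2 := by nlinarith
  obtain ⟨W, hWdef⟩ : ∃ W, W = Real.sqrt (s ^ 2 - (d * S) ^ 2) := ⟨_, rfl⟩
  have hW : 0 < W := hWdef ▸ Real.sqrt_pos.mpr hW2
  have hWsq : W ^ 2 = s ^ 2 - (d * S) ^ 2 := hWdef ▸ Real.sq_sqrt hW2.le
  obtain ⟨q, hqdef⟩ : ∃ q, q = Real.sqrt (s ^ 2 - d ^ 2) := ⟨_, rfl⟩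
  have hq : 0 < q := hqdef ▸ Real.sqrt_pos.mpr hq2
  have hqsq : q ^ 2 = s ^ 2 - d ^ 2 := hqdef ▸ Real.sq_sqrt hq2.le
  have hsinφ : Real.sqrt (1 - (-(d * S) / s) ^ 2) = W / s := by
    rw [show 1 - (-(d * S) / s) ^ 2 = (W / s) ^ 2 by rw [div_pow, div_pow, hWsq]; field_simp,
      Real.sqrt_sq (by positivity)]
  have hz : z1 = (s ^ 2 * C / (2 * W)) ^ 2 := by
    rw [hz1, show s ^ 2 * (1 / S) ^ 2 - d ^ 2 = W ^ 2 / S ^ 2 by rw [hWsq]; field_simp]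
    field_simp
    norm_num
  have huz : u ^ 2 - z1 = (s * S * q / (2 * W)) ^ 2 := by
    rw [hz, hu]
    field_simp
    linear_combination hWsq - S ^ 2 * hqsq - s ^ 2 * hSC
  have hr : 0 < s * (W - d * C) / (2 * W) := by
    have hlt : d * C < W := by
      refine lt_of_pow_lt_pow_left₀ 2 hW.le ?_
      nlinarith
    have : 0 < W - d * C := sub_pos.mpr hlt
    positivity
  apply ne_and_normalize_of_sub_eq_polar hr
  · rw [hh, hm, hcos, hsinφ, hz, Real.sqrt_sq (by positivity)]
    field_simp
    linear_combination -C * hWsq + d * W * hSC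
  · rw [hh, hm, hsin, hsinφ, huz, Real.sqrt_sq (by positivity), hv, ← hqdef, hu]
    field_simp
    linear_combination S * (hqsq - hWsq + d ^ 2 * hSC)
end
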